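/- arXiv:0809.0180 — 2 statements merged into one kernel-verified Lean document; each statement's English description precedes it below -/
import Mathlib

section
/- Let m ≥ 0 and n be integers, a ∈ fil_n W_{m+1}(K), α = α(a), and let b, c ∈ K be nonzero with b' ≠ 0 and c' ≠ 0; set ν(b) = ord(t·b'/b) and ν(c) = ord(t·c'/c). Assume ord(t·α) = −n, ord(α + c·b') ≥ −n + ν(c) + r, and ν(b) + ν(c) < (p−2)·r. Set E = W_{m+1}(u)(a) − W_{m+1}(v)(a) + V^m( v(c)·(u(b) − v(b)) ) ∈ W_{m+1}(L). Then E ∈ fil_{n−ν(c)−2r} W_{m+1}(L), and moreover E − V^m( v((1/2)·t²·α·c'/c)·t^{2r}·θ² ) ∈ fil_{n−ν(c)−2r−1} W_{m+1}(L). -/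
/-!
Setting: `p > 2` a prime, `k` a perfect field of characteristic `p`,
`K = k((t))` the field of formal Laurent series, `ord` the `t`-adic valuation
(with `ord 0 = +∞`, encoded below via the predicate `ordGe`),
`L = k(θ)((t))` with `k(θ) = RatFunc k`.
-/

noncomputable section

namespace LFT

variable {F : Type*} [Field F]

/-- The formal derivative of a Laurent series: the coefficient of `t^j` in `lsDeriv x`
is `(j+1)` times the coefficient of `t^{j+1}` in `x`. -/
def lsDeriv (x : LaurentSeries F) : LaurentSeries F where
  coeff j := (j + 1) • x.coeff (j + 1)
  isPWO_support' := by
    have h : Function.support (fun j : ℤ => (j + 1) • x.coeff (j + 1)) ⊆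
        (fun j : ℤ => j - 1) '' Function.support x.coeff := by
      intro j hj
      refine ⟨j + 1, ?_, by ring⟩
      intro h0
      simp [Function.mem_support, h0] at hj
    exact (x.isPWO_support'.image_of_monotone (fun a b hab => by omega)).mono h

/-- The uniformizer `t` of `F((t))`. -/
def tt : LaurentSeries F := HahnSeries.single 1 1

/-- `ordGe x N` means `ord x ≥ N`, with the convention `ord 0 = +∞`. -/
def ordGe (x : LaurentSeries F) (N : ℤ) : Prop := x = 0 ∨ N ≤ x.order

/-- The element `θ` of `k(θ) ⊆ k(θ)((t))`. -/
def θθ (k : Type*) [Field k] : LaurentSeries (RatFunc k) := HahnSeries.single 0 RatFunc.X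

/-- Membership in the level `N` of the Kato filtration `fil_N W_{m+1}(F((t)))`:
`p^{m-i}·ord(a_i) ≥ -N` for all `0 ≤ i ≤ m` (with `ord 0 = +∞`). -/
def inFil (p : ℕ) {m : ℕ} (N : ℤ) (a : TruncatedWittVector p (m + 1) (LaurentSeries F)) : Prop :=
  ∀ i : Fin (m + 1), a.coeff i = 0 ∨ -N ≤ (p : ℤ) ^ (m - (i : ℕ)) * (a.coeff i).order

/-- `α(a) = Σ_{i=0}^m a_i^{p^{m-i}-1}·a_i'`, so that `F^m d(a) = α(a)·dt`. -/
def alphaW (p : ℕ) {m : ℕ} (a : TruncatedWittVector p (m + 1) (LaurentSeries F)) :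
    LaurentSeries F :=
  ∑ i : Fin (m + 1), a.coeff i ^ (p ^ (m - (i : ℕ)) - 1) * lsDeriv (a.coeff i)

/-- The componentwise map `W_{m+1}(f)` on truncated Witt vectors induced by `f`. -/
def mapTW (p : ℕ) {m : ℕ} {K L : Type*} (f : K → L)
    (a : TruncatedWittVector p (m + 1) K) : TruncatedWittVector p (m + 1) L :=
  TruncatedWittVector.mk p fun i => f (a.coeff i)

/-- `V^m(z) = (0, …, 0, z)` in `W_{m+1}(L)`. -/
def Vm (p : ℕ) {m : ℕ} {L : Type*} [Zero L] (z : L) : TruncatedWittVector p (m + 1) L :=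
  TruncatedWittVector.mk p fun i => if (i : ℕ) = m then z else 0


section PartP1
variable {F : Type*} [Field F]

def Oh (N : ℤ) (x : LaurentSeries F) : Prop := ∀ j < N, x.coeff j = 0

theorem Oh_iff_orderTop {N : ℤ} {x : LaurentSeries F} : Oh N x ↔ (N : WithTop ℤ) ≤ x.orderTop := by
  rw [HahnSeries.le_orderTop_iff_forall]
  constructor
  · intro h j hj
    exact h j (by exact_mod_cast hj)
  · intro h j hj
    exact h j (by exact_mod_cast hj)

theorem Oh_iff_order {N : ℤ} {x : LaurentSeries F} : Oh N x ↔ (x = 0 ∨ N ≤ x.order) := by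
  rw [Oh_iff_orderTop]
  by_cases hx : x = 0
  · simp [hx]
  · rw [← HahnSeries.order_eq_orderTop_of_ne_zero hx]
    simp [hx]

theorem ordGe_iff {N : ℤ} {x : LaurentSeries F} : ordGe x N ↔ Oh N x := Oh_iff_order.symm

theorem Oh_order (x : LaurentSeries F) : Oh x.order x := Oh_iff_order.2 (Or.inr le_rfl)

theorem Oh.zero (N : ℤ) : Oh N (0 : LaurentSeries F) := fun _ _ => rfl

theorem Oh.mono {N M : ℤ} {x : LaurentSeries F} (h : Oh N x) (hM : M ≤ N) : Oh M x :=
  fun j hj => h j (by omega)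

theorem Oh.add {N : ℤ} {x y : LaurentSeries F} (hx : Oh N x) (hy : Oh N y) : Oh N (x + y) :=
  fun j hj => by simp [hx j hj, hy j hj]

theorem Oh.neg {N : ℤ} {x : LaurentSeries F} (hx : Oh N x) : Oh N (-x) :=
  fun j hj => by simp [hx j hj]

theorem Oh.sub {N : ℤ} {x y : LaurentSeries F} (hx : Oh N x) (hy : Oh N y) : Oh N (x - y) :=
  fun j hj => by simp [hx j hj, hy j hj]

theorem Oh.sum {ι : Type*} {N : ℤ} (s : Finset ι) {f : ι → LaurentSeries F}
    (h : ∀ i ∈ s, Oh N (f i)) : Oh N (∑ i ∈ s, f i) := by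
  classical
  induction s using Finset.induction_on with
  | empty => simpa using Oh.zero N
  | insert a s ha ih =>
    rw [Finset.sum_insert ha]
    exact (h a (by simp)).add (ih fun i hi => h i (by simp [hi]))

theorem Oh.mul {N M : ℤ} {x y : LaurentSeries F} (hx : Oh N x) (hy : Oh M y) :
    Oh (N + M) (x * y) := by
  rw [Oh_iff_orderTop] at *
  rw [HahnSeries.orderTop_mul]
  push_cast
  exact add_le_add hx hy

theorem Oh.mul' {N M P : ℤ} {x y : LaurentSeries F} (hx : Oh N x) (hy : Oh M y) (h : P ≤ N + M) :
    Oh P (x * y) := (hx.mul hy).mono h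

theorem Oh_single (j : ℤ) (c : F) : Oh j (HahnSeries.single j c : LaurentSeries F) :=
  fun i hi => HahnSeries.coeff_single_of_ne (by omega)

theorem Oh_one : Oh 0 (1 : LaurentSeries F) := Oh_single 0 1

theorem Oh_tt : Oh 1 (tt : LaurentSeries F) := Oh_single 1 1

theorem Oh.pow {N : ℤ} {x : LaurentSeries F} (hx : Oh N x) (n : ℕ) : Oh (n * N) (x ^ n) := by
  induction n with
  | zero => simpa using Oh_one
  | succ n ih => rw [pow_succ]; exact ih.mul' hx (by push_cast; linarith)

theorem Oh_cancel {N M : ℤ} {x y : LaurentSeries F} (hx : x ≠ 0) (hxo : x.order = M)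
    (h : Oh (N + M) (x * y)) : Oh N y := by
  rw [Oh_iff_order] at *
  rcases h with h | h
  · left; simpa [hx] using h
  · by_cases hy : y = 0
    · exact Or.inl hy
    · right
      rw [HahnSeries.order_mul hx hy] at h
      omega

theorem Oh_inv {N : ℤ} {x : LaurentSeries F} (hx : x ≠ 0) (hxo : x.order = N) : Oh (-N) x⁻¹ := by
  apply Oh_cancel hx hxo
  rw [mul_inv_cancel₀ hx]
  simpa using Oh_one

theorem Oh_intCast (z : ℤ) : Oh 0 (z : LaurentSeries F) := by
  have : (z : LaurentSeries F) = HahnSeries.single 0 (z : F) := by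
    rw [← HahnSeries.C_apply, map_intCast]
  rw [this]
  exact Oh_single _ _

theorem Oh_natCast (z : ℕ) : Oh 0 (z : LaurentSeries F) := by
  exact_mod_cast Oh_intCast (F := F) z

theorem natCast_eq_single (z : ℕ) : (z : LaurentSeries F) = HahnSeries.single 0 (z : F) := by
  rw [← HahnSeries.C_apply, map_natCast]

theorem Oh_natCast_inv (z : ℕ) : Oh 0 ((z : LaurentSeries F)⁻¹) := by
  by_cases h : (z : F) = 0
  · rw [natCast_eq_single, h]; simpa using Oh.zero 0
  · have h2 : (z : LaurentSeries F) ≠ 0 := by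
      rw [natCast_eq_single]; simpa using h
    have := Oh_inv (N := 0) h2 (by rw [natCast_eq_single]; exact HahnSeries.order_single h)
    simpa using this

/-- Euler operator -/
theorem lsDeriv_coeff (x : LaurentSeries F) (j : ℤ) :
    (lsDeriv x).coeff j = (j + 1) • x.coeff (j + 1) := rfl

theorem tt_mul_coeff (x : LaurentSeries F) (j : ℤ) : (tt * x).coeff j = x.coeff (j - 1) := by
  have := HahnSeries.coeff_single_mul_add (r := (1 : F)) (x := x) (a := j - 1) (b := 1)
  simpa [tt] using this

theorem tt_ne_zero : (tt : LaurentSeries F) ≠ 0 := by simp [tt]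

theorem lsDeriv_mul (x y : LaurentSeries F) :
    lsDeriv (x * y) = x * lsDeriv y + y * lsDeriv x := by
  have e : ∀ x : LaurentSeries F, ∀ j, (tt * lsDeriv x).coeff j = j • x.coeff j := by
    intro x j
    rw [tt_mul_coeff, lsDeriv_coeff]; simp
  have hs : ∀ x : LaurentSeries F, (tt * lsDeriv x).support ⊆ x.support := by
    intro x j hj
    rw [HahnSeries.mem_support] at *
    intro h; rw [e, h] at hj; simp at hj
  apply mul_left_cancel₀ (tt_ne_zero (F := F))
  rw [mul_add, mul_left_comm tt x, mul_left_comm tt y, mul_comm y]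
  ext j
  rw [e, HahnSeries.coeff_add, HahnSeries.coeff_mul_left' x.isPWO_support (hs x),
    HahnSeries.coeff_mul_right' y.isPWO_support (hs y), HahnSeries.coeff_mul,
    ← Finset.sum_add_distrib, Finset.smul_sum]
  apply Finset.sum_congr rfl
  rintro ⟨a, b⟩ hab
  have := (Finset.mem_antidiagonal.1 hab).2.2
  simp only at this ⊢
  rw [e, e, ← this]
  simp only [zsmul_eq_mul]; push_cast; ring

theorem lsDeriv_add (x y : LaurentSeries F) : lsDeriv (x + y) = lsDeriv x + lsDeriv y := by
  ext j; simp [lsDeriv_coeff]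

variable (F) in
def dD : LaurentSeries F →+ LaurentSeries F where
  toFun := lsDeriv
  map_add' := lsDeriv_add
  map_zero' := by ext j; simp [lsDeriv_coeff]

theorem dD_apply (x : LaurentSeries F) : dD F x = lsDeriv x := rfl

theorem dD_mul (x y : LaurentSeries F) : dD F (x * y) = x * dD F y + y * dD F x :=
  lsDeriv_mul x y

theorem Oh.deriv {N : ℤ} {x : LaurentSeries F} (h : Oh N x) : Oh (N - 1) (dD F x) := by
  intro j hj
  rw [dD_apply, lsDeriv_coeff, h _ (by omega), smul_zero]

theorem Oh.iter {N : ℤ} {x : LaurentSeries F} (h : Oh N x) (s : ℕ) :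
    Oh (N - s) ((dD F)^[s] x) := by
  induction s with
  | zero => simpa using h
  | succ s ih =>
    rw [Function.iterate_succ_apply']
    exact ih.deriv.mono (by push_cast; omega)

theorem dD_tt : dD F tt = 1 := by
  ext j
  rw [dD_apply, lsDeriv_coeff]
  by_cases h : j = 0
  · subst h; simp [tt]
  · rw [tt, HahnSeries.coeff_single_of_ne (by omega), HahnSeries.coeff_one]; simp [h]

theorem dD_const (c : F) : dD F (HahnSeries.single 0 c) = 0 := by
  ext j
  rw [dD_apply, lsDeriv_coeff]
  by_cases h : j = -1
  · subst h; simp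
  · rw [HahnSeries.coeff_single_of_ne (by omega)]; simp

end PartP1

section PartP2
open Polynomial

section Abstract
variable {K : Type*} [Field K] (p : ℕ) [hpf : Fact p.Prime] [CharP K p]

theorem fact_ne_zero {s : ℕ} (hs : s < p) : ((s.factorial : ℕ) : K) ≠ 0 := by
  rw [Ne, CharP.cast_eq_zero_iff K p, hpf.out.dvd_factorial]
  omega

variable (d : K →+ K)

def eT (s : ℕ) (x : K) : K := ((s.factorial : ℕ) : K)⁻¹ * d^[s] x

def TT (x : K) : K[X] := ∑ s ∈ Finset.range p, C (eT d s x) * X ^ s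

def AA (y : K) : K[X] :=
  ∑ s ∈ Finset.range (p - 1), C ((((s + 1).factorial : ℕ) : K)⁻¹ * d^[s] y) * X ^ (s + 1)

omit hpf [CharP K p] in
theorem TT_coeff (x : K) (s : ℕ) : (TT p d x).coeff s = if s < p then eT d s x else 0 := by
  simp [TT, coeff_C_mul, coeff_X_pow]

omit hpf [CharP K p] in
theorem AA_coeff_zero (y : K) : (AA p d y).coeff 0 = 0 := by
  simp [AA, coeff_X_pow]

omit hpf [CharP K p] in
theorem AA_coeff_succ (y : K) (s : ℕ) : (AA p d y).coeff (s + 1) =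
    if s < p - 1 then (((s + 1).factorial : ℕ) : K)⁻¹ * d^[s] y else 0 := by
  simp only [AA, finsetSum_coeff, coeff_C_mul, coeff_X_pow, mul_ite, mul_one, mul_zero,
    add_left_inj, Finset.sum_ite_eq, Finset.mem_range]

theorem iter_add (s : ℕ) (x y : K) : d^[s] (x + y) = d^[s] x + d^[s] y := by
  induction s generalizing x y with
  | zero => rfl
  | succ s ih => simp [Function.iterate_succ_apply, ih]

omit hpf [CharP K p] in
theorem AA_add (y z : K) : AA p d (y + z) = AA p d y + AA p d z := by
  simp [AA, mul_add, add_mul, Finset.sum_add_distrib]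

omit hpf [CharP K p] in
theorem TT_add (y z : K) : TT p d (y + z) = TT p d y + TT p d z := by
  simp [TT, eT, mul_add, add_mul, Finset.sum_add_distrib]

omit [CharP K p] in
theorem TT_sub_C (x : K) : TT p d x - C x = AA p d (d x) := by
  ext s
  cases s with
  | zero => simp [TT_coeff, AA_coeff_zero, hpf.out.pos, eT]
  | succ s =>
    rw [coeff_sub, TT_coeff, AA_coeff_succ, coeff_C_succ, sub_zero]
    have : s + 1 < p ↔ s < p - 1 := by omega
    simp [this, eT, Function.iterate_succ_apply]

variable (hd : ∀ x y, d (x * y) = x * d y + y * d x)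
include hd

theorem d_one : d 1 = 0 := by
  have := hd 1 1
  simpa using this

theorem d_natCast (n : ℕ) : d (n : K) = 0 := by
  induction n with
  | zero => simp
  | succ n ih => simp [ih, d_one d hd]

theorem d_inv_of (c : K) (hc : d c = 0) : d c⁻¹ = 0 := by
  by_cases h : c = 0
  · simp [h]
  · have := hd c c⁻¹
    rw [mul_inv_cancel₀ h, d_one d hd, hc] at this
    simpa [h] using this.symm

theorem d_const_mul (c x : K) (hc : d c = 0) : d (c * x) = c * d x := by
  rw [hd, hc]; simp

theorem iter_const_mul (c x : K) (hc : d c = 0) (s : ℕ) : d^[s] (c * x) = c * d^[s] x := by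
  induction s with
  | zero => rfl
  | succ s ih => rw [Function.iterate_succ_apply', ih, d_const_mul d hd _ _ hc,
      Function.iterate_succ_apply']

theorem d_pow (x : K) (n : ℕ) : d (x ^ n) = n * x ^ (n - 1) * d x := by
  induction n with
  | zero => simp [d_one d hd]
  | succ n ih =>
    rw [pow_succ, hd, ih]
    cases n with
    | zero => simp
    | succ n => simp only [Nat.add_sub_cancel]; push_cast; ring

omit hpf in
theorem d_pow_p (x : K) (M : ℕ) (hM : M ≠ 0) : d (x ^ p ^ M) = 0 := by
  rw [d_pow d hd]
  simp [hM]

omit hpf [CharP K p] in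
theorem AA_const_mul (c x : K) (hc : d c = 0) : AA p d (c * x) = C c * AA p d x := by
  rw [AA, AA, Finset.mul_sum]
  apply Finset.sum_congr rfl
  intro s _
  rw [iter_const_mul d hd _ _ hc, ← mul_assoc (C c), ← C_mul]
  congr 2
  ring

theorem d_eT {s : ℕ} (hs : s + 1 < p) (x : K) : d (eT d s x) = ((s + 1 : ℕ) : K) * eT d (s + 1) x := by
  have h1 := fact_ne_zero (K := K) p hs
  have h2 := fact_ne_zero (K := K) p (show s < p by omega)
  rw [eT, d_const_mul d hd _ _ (d_inv_of d hd _ (d_natCast d hd _)), eT,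
    Function.iterate_succ_apply', ← mul_assoc]
  congr 1
  rw [Nat.factorial_succ] at h1 ⊢
  rw [Nat.cast_mul] at h1 ⊢
  have h3 : ((s + 1 : ℕ) : K) ≠ 0 := left_ne_zero_of_mul h1
  field_simp

theorem eT_mul (x y : K) {s : ℕ} (hs : s < p) :
    eT d s (x * y) = ∑ ij ∈ Finset.HasAntidiagonal.antidiagonal s, eT d ij.1 x * eT d ij.2 y := by
  induction s with
  | zero => simp [eT]
  | succ s ih =>
    have h1 := fact_ne_zero (K := K) p hs
    rw [Nat.factorial_succ, Nat.cast_mul] at h1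
    have h3 : ((s + 1 : ℕ) : K) ≠ 0 := left_ne_zero_of_mul h1
    apply mul_left_cancel₀ h3
    rw [← d_eT p d hd hs, ih (by omega), map_sum]
    have e1 : ((s + 1 : ℕ) : K) * ∑ ij ∈ Finset.HasAntidiagonal.antidiagonal (s + 1), eT d ij.1 x * eT d ij.2 y
      = ∑ ij ∈ Finset.HasAntidiagonal.antidiagonal (s + 1), (ij.1 : K) * (eT d ij.1 x * eT d ij.2 y)
      + ∑ ij ∈ Finset.HasAntidiagonal.antidiagonal (s + 1), (ij.2 : K) * (eT d ij.1 x * eT d ij.2 y) := by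
      rw [← Finset.sum_add_distrib, Finset.mul_sum]
      apply Finset.sum_congr rfl
      intro ij hij
      rw [← Finset.HasAntidiagonal.mem_antidiagonal.1 hij]
      push_cast; ring
    rw [e1, Finset.Nat.sum_antidiagonal_succ, Finset.Nat.sum_antidiagonal_succ']
    simp only [Nat.cast_zero, zero_mul, zero_add, add_zero]
    rw [← Finset.sum_add_distrib]
    apply Finset.sum_congr rfl
    intro ij hij
    have := Finset.HasAntidiagonal.mem_antidiagonal.1 hij
    rw [hd, d_eT p d hd (by omega), d_eT p d hd (by omega)]
    ring

theorem TT_mul (x y : K) : X ^ p ∣ TT p d (x * y) - TT p d x * TT p d y := by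
  rw [X_pow_dvd_iff]
  intro s hs
  rw [coeff_sub, TT_coeff, if_pos hs, coeff_mul, eT_mul p d hd x y hs, sub_eq_zero]
  apply Finset.sum_congr rfl
  intro ij hij
  have := Finset.HasAntidiagonal.mem_antidiagonal.1 hij
  rw [TT_coeff, TT_coeff, if_pos (by omega), if_pos (by omega)]

theorem TT_deriv (x : K) : X ^ (p - 1) ∣ derivative (TT p d x) - TT p d (d x) := by
  rw [X_pow_dvd_iff]
  intro s hs
  rw [coeff_sub, coeff_derivative, TT_coeff, TT_coeff, if_pos (by omega), if_pos (by omega)]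
  have := d_eT p d hd (show s + 1 < p by omega) x
  have h2 : eT d s (d x) = d (eT d s x) := by
    rw [eT, eT, d_const_mul d hd _ _ (d_inv_of d hd _ (d_natCast d hd _)),
      ← Function.iterate_succ_apply, Function.iterate_succ_apply']
  rw [h2, this]; push_cast; ring

omit hd in
theorem AA_deriv (x : K) : X ^ (p - 1) ∣ derivative (AA p d x) - TT p d x := by
  rw [X_pow_dvd_iff]
  intro s hs
  rw [coeff_sub, coeff_derivative, TT_coeff, AA_coeff_succ, if_pos (by omega), if_pos (by omega), eT]
  have h1 := fact_ne_zero (K := K) p (show s + 1 < p by omega)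
  have h2 := fact_ne_zero (K := K) p (show s < p by omega)
  rw [Nat.factorial_succ] at h1 ⊢
  rw [Nat.cast_mul] at h1 ⊢
  have h3 : ((s + 1 : ℕ) : K) ≠ 0 := left_ne_zero_of_mul h1
  push_cast at h3 ⊢
  field_simp
  ring

theorem log_lemma (S : K[X]) (hS0 : S.coeff 0 = 0)
    (hS : X ^ (p - 1) ∣ (1 + X) * derivative S - 1) (x : K) (hx : x ≠ 0) :
    X ^ p ∣ S.comp (C x⁻¹ * TT p d x - 1) - AA p d (x⁻¹ * d x) := by
  set P : K[X] := C x⁻¹ * TT p d x - 1 with hP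
  have hP0 : P.coeff 0 = 0 := by
    simp [hP, TT_coeff, hpf.out.pos, eT, hx]
  have hXP : X ∣ P := X_dvd_iff.2 hP0
  set Q := S.comp P - AA p d (x⁻¹ * d x) with hQ
  have hQ0 : Q.coeff 0 = 0 := by
    rw [hQ, coeff_sub, AA_coeff_zero, coeff_zero_eq_eval_zero, eval_comp, ← coeff_zero_eq_eval_zero,
      hP0, ← coeff_zero_eq_eval_zero, hS0, sub_zero]
  have h1 : X ^ (p - 1) ∣ ((1 + P) * (derivative S).comp P - 1) := by
    obtain ⟨W, hW⟩ := hS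
    have := congrArg (fun q => q.comp P) hW
    simp only [sub_comp, mul_comp, add_comp, one_comp, X_comp, pow_comp] at this
    rw [this]
    exact (pow_dvd_pow_of_dvd hXP _).mul_right _
  have hmul : X ^ (p - 1) ∣ TT p d (d x) - TT p d x * TT p d (x⁻¹ * d x) := by
    have := TT_mul p d hd x (x⁻¹ * d x)
    rw [mul_inv_cancel_left₀ hx] at this
    exact (pow_dvd_pow X (by omega)).trans this
  have h2 : X ^ (p - 1) ∣ (1 + P) * derivative Q := by
    have hPd : derivative P = C x⁻¹ * derivative (TT p d x) := by simp [hP]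
    have h1P : 1 + P = C x⁻¹ * TT p d x := by rw [hP]; ring
    have e : (1 + P) * derivative Q = derivative P * ((1 + P) * (derivative S).comp P - 1)
        + C x⁻¹ * (derivative (TT p d x) - TT p d (d x))
        + C x⁻¹ * (TT p d (d x) - TT p d x * TT p d (x⁻¹ * d x))
        - (1 + P) * (derivative (AA p d (x⁻¹ * d x)) - TT p d (x⁻¹ * d x)) := by
      rw [hQ, derivative_sub, derivative_comp, hPd, h1P]
      ring
    rw [e]
    exact dvd_sub (dvd_add (dvd_add (h1.mul_left _) ((TT_deriv p d hd x).mul_left _))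
      (hmul.mul_left _)) ((AA_deriv p d _).mul_left _)
  have h3 : X ^ (p - 1) ∣ derivative Q := by
    apply prime_X.pow_dvd_of_dvd_mul_left _ _ h2
    rw [X_dvd_iff, coeff_add, hP0]
    simp
  rw [X_pow_dvd_iff] at h3 ⊢
  intro s hs
  cases s with
  | zero => exact hQ0
  | succ s =>
    have := h3 s (by omega)
    rw [coeff_derivative] at this
    have h1 := fact_ne_zero (K := K) p hs
    rw [Nat.factorial_succ, Nat.cast_mul] at h1
    have h4 : ((s + 1 : ℕ) : K) ≠ 0 := left_ne_zero_of_mul h1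
    push_cast at h4
    simpa [h4] using this

end Abstract

section Witt
variable (p : ℕ) [hpf : Fact p.Prime]
open WittVector

def SW : WittVector p ℤ[X] := teichmuller p (1 + X) - 1

theorem SW_zero (j : ℕ) : X ∣ (SW p).coeff j := by
  rw [X_dvd_iff, coeff_zero_eq_eval_zero]
  have h : WittVector.map (evalRingHom (0 : ℤ)) (SW p) = 0 := by
    rw [SW, map_sub, map_teichmuller, map_one]
    simp
  have := congrArg (fun w => w.coeff j) h
  simpa [map_coeff] using this

theorem SW_ghost (M : ℕ) : ∑ i ∈ Finset.range (M + 1),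
    (p : ℤ[X]) ^ i * (SW p).coeff i ^ p ^ (M - i) = (1 + X) ^ p ^ M - 1 := by
  have h : ghostComponent M (SW p) = (1 + X) ^ p ^ M - 1 := by
    rw [SW, map_sub, ghostComponent_teichmuller, map_one]
  rw [ghostComponent_apply, aeval_wittPolynomial] at h
  exact h

theorem SW_deriv_int (M : ℕ) : X ^ (p - 1) ∣
    derivative ((SW p).coeff M) - (1 + X) ^ (p ^ M - 1) := by
  have h := SW_ghost p M
  rw [Finset.sum_range_succ, Nat.sub_self, pow_zero, pow_one] at h
  have hd : X ^ p ∣ ∑ i ∈ Finset.range M, (p : ℤ[X]) ^ i * (SW p).coeff i ^ p ^ (M - i) := by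
    apply Finset.dvd_sum
    intro i hi
    have : X ^ p ^ (M - i) ∣ (SW p).coeff i ^ p ^ (M - i) := pow_dvd_pow_of_dvd (SW_zero p i) _
    refine (dvd_trans (pow_dvd_pow X ?_) this).mul_left _
    apply Nat.le_self_pow
    have := Finset.mem_range.1 hi
    omega
  obtain ⟨W, hW⟩ := hd
  rw [hW] at h
  have h2 := congrArg derivative h
  have h3 : (p : ℤ[X]) ^ M * (derivative ((SW p).coeff M) - (1 + X) ^ (p ^ M - 1)) =
      - derivative (X ^ p * W) := by
    have e : derivative ((p : ℤ[X]) ^ M * (SW p).coeff M) =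
      (p : ℤ[X]) ^ M * derivative ((SW p).coeff M) := by
      rw [← Nat.cast_pow, ← C_eq_natCast, derivative_C_mul]
    rw [derivative_add, e, derivative_sub, derivative_one, derivative_pow] at h2
    simp only [derivative_add, derivative_one, derivative_X] at h2
    rw [C_eq_natCast] at h2
    push_cast at h2
    linear_combination h2
  have h4 : X ^ (p - 1) ∣ derivative (X ^ p * W) := by
    rw [derivative_mul, derivative_X_pow]
    exact dvd_add (((dvd_refl _).mul_left _).mul_right _) ((pow_dvd_pow X (by omega)).mul_right _)
  rw [← dvd_neg, ← h3, X_pow_dvd_iff] at h4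
  rw [X_pow_dvd_iff]
  intro s hs
  have := h4 s hs
  rw [← Nat.cast_pow, ← C_eq_natCast, coeff_C_mul] at this
  have hp : ((p ^ M : ℕ) : ℤ) ≠ 0 := by exact_mod_cast pow_ne_zero _ hpf.out.ne_zero
  exact (mul_eq_zero.1 this).resolve_left hp

theorem SW_deriv (K : Type*) [Field K] [CharP K p] (M : ℕ) (hM : M ≠ 0) : X ^ (p - 1) ∣
    (1 + X) * derivative (((SW p).coeff M).map (Int.castRingHom K)) - 1 := by
  have h := Polynomial.map_dvd (Int.castRingHom K) (SW_deriv_int p M)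
  rw [Polynomial.map_sub, ← derivative_map] at h
  simp only [Polynomial.map_pow, Polynomial.map_add, Polynomial.map_X, Polynomial.map_one] at h
  have h2 : ((1 : K[X]) + X) * (1 + X) ^ (p ^ M - 1) = 1 + X ^ p ^ M := by
    rw [mul_pow_sub_one (pow_ne_zero _ hpf.out.ne_zero), add_pow_char_pow, one_pow]
  have h3 : (1 + X) * derivative (((SW p).coeff M).map (Int.castRingHom K)) - 1
    = (1 + X) * (derivative (((SW p).coeff M).map (Int.castRingHom K)) - (1 + X) ^ (p ^ M - 1))
      + X ^ p ^ M := by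
    linear_combination h2
  rw [h3]
  refine dvd_add (h.mul_left _) (pow_dvd_pow X ?_)
  have := Nat.le_self_pow hM p
  omega

end Witt

end PartP2

section PartP3
open Polynomial

instance charPLaurent (F : Type*) [Field F] (p : ℕ) [CharP F p] : CharP (LaurentSeries F) p :=
  charP_of_injective_ringHom (HahnSeries.C_injective (Γ := ℤ) (R := F)) p

section Weight
variable {F : Type*} [Field F]

/-- `P = ∑ P_s H^s` with `ord P_s ≥ w - s`. -/
def wt (w : ℤ) (P : (LaurentSeries F)[X]) : Prop := ∀ s : ℕ, Oh (w - s) (P.coeff s)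

theorem wt.add {w : ℤ} {P Q : (LaurentSeries F)[X]} (hP : wt w P) (hQ : wt w Q) : wt w (P + Q) :=
  fun s => by rw [coeff_add]; exact (hP s).add (hQ s)

theorem wt.sub {w : ℤ} {P Q : (LaurentSeries F)[X]} (hP : wt w P) (hQ : wt w Q) : wt w (P - Q) :=
  fun s => by rw [coeff_sub]; exact (hP s).sub (hQ s)

theorem wt.mono {w w' : ℤ} {P : (LaurentSeries F)[X]} (hP : wt w P) (h : w' ≤ w) : wt w' P :=
  fun s => (hP s).mono (by omega)

theorem wt.mul {w w' : ℤ} {P Q : (LaurentSeries F)[X]} (hP : wt w P) (hQ : wt w' Q) :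
    wt (w + w') (P * Q) := fun s => by
  rw [coeff_mul]
  apply Oh.sum
  intro ij hij
  have := Finset.HasAntidiagonal.mem_antidiagonal.1 hij
  exact (hP _).mul' (hQ _) (by omega)

theorem wt_C {w : ℤ} {x : LaurentSeries F} (hx : Oh w x) : wt w (C x) := fun s => by
  rw [coeff_C]
  split_ifs with h
  · subst h; simpa using hx
  · exact Oh.zero _

theorem wt_one : wt 0 (1 : (LaurentSeries F)[X]) := by
  rw [← C_1]; exact wt_C Oh_one

theorem wt.pow {P : (LaurentSeries F)[X]} (hP : wt 0 P) (n : ℕ) : wt 0 (P ^ n) := by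
  induction n with
  | zero => rw [pow_zero]; exact wt_one
  | succ n ih => rw [pow_succ]; simpa using ih.mul hP

theorem wt.comp_int (S : ℤ[X]) {P : (LaurentSeries F)[X]} (hP : wt 0 P) :
    wt 0 ((S.map (Int.castRingHom (LaurentSeries F))).comp P) := by
  induction S using Polynomial.induction_on' with
  | add a b ha hb => simpa using ha.add hb
  | monomial n a =>
    rw [Polynomial.map_monomial, monomial_comp]
    have : wt 0 (C ((Int.castRingHom (LaurentSeries F)) a)) := wt_C (by simpa using Oh_intCast a)
    simpa using this.mul (hP.pow n)

theorem wt_TT (p : ℕ) {w : ℤ} {x : LaurentSeries F} (hx : Oh w x) : wt w (TT p (dD F) x) := fun s => by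
  rw [TT_coeff]
  split_ifs
  · exact (Oh_natCast_inv _).mul' (hx.iter s) (by omega)
  · exact Oh.zero _

theorem wt_AA (p : ℕ) {w : ℤ} {x : LaurentSeries F} (hx : Oh (w - 1) x) : wt w (AA p (dD F) x) := fun s => by
  cases s with
  | zero => rw [AA_coeff_zero]; exact Oh.zero _
  | succ s =>
    rw [AA_coeff_succ]
    split_ifs
    · exact (Oh_natCast_inv _).mul' (hx.iter s) (by push_cast; omega)
    · exact Oh.zero _

end Weight

section Setup
variable {k : Type*} [Field k]

structure Setup (r : ℕ) (u v : LaurentSeries k →+* LaurentSeries (RatFunc k)) : Prop where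
  hr : 1 ≤ r
  hv : ∀ (x : LaurentSeries k) (j : ℤ),
      (v x).coeff j = algebraMap k (RatFunc k) (x.coeff j)
  hu_alg : ∀ c : k,
      u (HahnSeries.single 0 c) = HahnSeries.single 0 (algebraMap k (RatFunc k) c)
  hu_t : u tt = tt * (1 + tt ^ r * θθ k)
  hu_cont : ∀ N : ℤ, ∃ M : ℤ, ∀ x : LaurentSeries k, ordGe x M → ordGe (u x) N

variable (k) in
def hh (r : ℕ) : LaurentSeries (RatFunc k) := tt ^ (r + 1) * θθ k

theorem Oh_hh (r : ℕ) : Oh ((r : ℤ) + 1) (hh k r) := by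
  have h1 := (Oh_tt (F := RatFunc k)).pow (r + 1)
  have h2 : Oh 0 (θθ k) := Oh_single _ _
  exact h1.mul' h2 (by push_cast; omega)

def ev (r : ℕ) (v : LaurentSeries k →+* LaurentSeries (RatFunc k)) :
    (LaurentSeries k)[X] →+* LaurentSeries (RatFunc k) := eval₂RingHom v (hh k r)

variable {r : ℕ} {u v : LaurentSeries k →+* LaurentSeries (RatFunc k)}

theorem ev_C (x : LaurentSeries k) : ev r v (C x) = v x := by simp [ev]

theorem ev_X : ev r v X = hh k r := by simp [ev]

theorem Setup.Oh_v (H : Setup r u v) {N : ℤ} {x : LaurentSeries k} (hx : Oh N x) : Oh N (v x) :=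
  fun j hj => by rw [H.hv, hx j hj, map_zero]

theorem Setup.Oh_ev (H : Setup r u v) {w : ℤ} {P : (LaurentSeries k)[X]} (q : ℕ) (hP : wt w P)
    (hq : X ^ q ∣ P) : Oh (w + q * r) (ev r v P) := by
  rw [X_pow_dvd_iff] at hq
  rw [ev, coe_eval₂RingHom, eval₂_eq_sum, Polynomial.sum]
  apply Oh.sum
  intro s _
  by_cases hs : s < q
  · rw [hq s hs]; simpa using Oh.zero _
  · have h1 := H.Oh_v (hP s)
    refine h1.mul' ((Oh_hh r).pow s) ?_
    push Not at hs
    have : (q : ℤ) * r ≤ s * r := by exact_mod_cast Nat.mul_le_mul_right r hs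
    linarith

theorem Setup.Oh_ev0 (H : Setup r u v) {w : ℤ} {P : (LaurentSeries k)[X]} (hP : wt w P) :
    Oh w (ev r v P) := by
  simpa using H.Oh_ev 0 hP (by simp)

variable (p : ℕ) [hpf : Fact p.Prime] [CharP k p]

/-- the Taylor estimate -/
def TE (r : ℕ) (u v : LaurentSeries k →+* LaurentSeries (RatFunc k)) (N : ℤ) (x : LaurentSeries k) :
    Prop := Oh N x ∧ Oh (N + p * r) (u x - ev r v (TT p (dD k) x))

variable {p}

omit hpf [CharP k p] in
theorem TE.ou (H : Setup r u v) {N : ℤ} {x : LaurentSeries k} (h : TE p r u v N x) : Oh N (u x) := by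
  have h1 := H.Oh_ev0 (wt_TT p h.1)
  have h2 := (h.2.mono (show N ≤ N + p * r from le_add_of_nonneg_right (by positivity))).add h1
  simpa using h2

theorem TE.mul (H : Setup r u v) {N M : ℤ} {x y : LaurentSeries k} (hx : TE p r u v N x)
    (hy : TE p r u v M y) : TE p r u v (N + M) (x * y) := by
  refine ⟨hx.1.mul hy.1, ?_⟩
  have e : u (x * y) - ev r v (TT p (dD k) (x * y)) =
    (u x - ev r v (TT p (dD k) x)) * u y + ev r v (TT p (dD k) x) * (u y - ev r v (TT p (dD k) y))
    - ev r v (TT p (dD k) (x * y) - TT p (dD k) x * TT p (dD k) y) := by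
    simp only [map_sub, map_mul]; ring
  rw [e]
  have h3 : wt (N + M) (TT p (dD k) (x * y) - TT p (dD k) x * TT p (dD k) y) :=
    (wt_TT p (hx.1.mul hy.1)).sub ((wt_TT p hx.1).mul (wt_TT p hy.1))
  refine Oh.sub (Oh.add (hx.2.mul' (hy.ou H) (by linarith))
    ((H.Oh_ev0 (wt_TT p hx.1)).mul' hy.2 (by linarith))) (H.Oh_ev p h3 (TT_mul p _ dD_mul x y))

omit hpf [CharP k p] in
theorem AA_zero : AA p (dD k) 0 = 0 := by
  have := AA_add p (dD k) 0 0
  simpa using this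

omit [CharP k p] in
theorem ev_TT_const (c : LaurentSeries k) (hc : dD k c = 0) : ev r v (TT p (dD k) c) = v c := by
  have := TT_sub_C p (dD k) c
  rw [hc, AA_zero, sub_eq_zero] at this
  rw [this, ev_C]

omit [CharP k p] in
theorem TE_const (H : Setup r u v) (c : k) : TE p r u v 0 (HahnSeries.single 0 c) := by
  refine ⟨Oh_single _ _, ?_⟩
  rw [ev_TT_const _ (dD_const c), H.hu_alg]
  have : v (HahnSeries.single 0 c) = HahnSeries.single 0 (algebraMap k (RatFunc k) c) := by
    ext j
    rw [H.hv]
    by_cases h : j = 0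
    · subst h; simp
    · rw [HahnSeries.coeff_single_of_ne h, HahnSeries.coeff_single_of_ne h, map_zero]
  rw [this, sub_self]
  exact Oh.zero _

theorem v_tt (H : Setup r u v) : v tt = tt := by
  ext j
  rw [H.hv, tt, tt]
  by_cases h : j = 1
  · subst h; simp
  · rw [HahnSeries.coeff_single_of_ne h, HahnSeries.coeff_single_of_ne h, map_zero]

omit [CharP k p] in
theorem TT_tt : TT p (dD k) tt = C tt + X := by
  have := TT_sub_C p (dD k) tt
  rw [dD_tt] at this
  rw [eq_add_of_sub_eq' this]
  congr 1
  ext s : 1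
  cases s with
  | zero => rw [AA_coeff_zero]; simp
  | succ s =>
    rw [AA_coeff_succ]
    cases s with
    | zero => have := hpf.out.one_lt; simp [this]
    | succ s =>
      have : (dD k)^[s + 1] (1 : LaurentSeries k) = 0 := by
        rw [Function.iterate_succ_apply, d_one _ dD_mul]
        exact iterate_map_zero _ _
      rw [this]; simp [coeff_X]

omit [CharP k p] in
theorem u_tt (H : Setup r u v) : u tt = ev r v (TT p (dD k) tt) := by
  rw [TT_tt, map_add, ev_C, ev_X, v_tt H, H.hu_t, hh]; ring

omit [CharP k p] in
theorem TE_tt (H : Setup r u v) : TE p r u v 1 tt := by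
  refine ⟨Oh_tt, ?_⟩
  rw [← u_tt H, sub_self]; exact Oh.zero _

theorem u_tt_order (H : Setup r u v) : (u tt).order = 1 := by
  have e : u tt = tt + hh k r := by rw [H.hu_t, hh]; ring
  have hr := H.hr
  have h1 : Oh 1 (u tt) := by
    rw [e]; exact Oh_tt.add ((Oh_hh r).mono (by omega))
  have h2 : (u tt).coeff 1 = 1 := by
    rw [e, HahnSeries.coeff_add, Oh_hh r 1 (by omega)]; simp [tt]
  have h3 : (u tt).coeff 1 ≠ 0 := by rw [h2]; exact one_ne_zero
  have h4 := HahnSeries.order_le_of_coeff_ne_zero h3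
  rcases Oh_iff_order.1 h1 with h | h
  · rw [h] at h3; simp at h3
  · omega

theorem TE_tt_inv (H : Setup r u v) : TE p r u v (-1) (tt⁻¹) := by
  have h0 : Oh (-1) (tt⁻¹ : LaurentSeries k) := Oh_inv tt_ne_zero (HahnSeries.order_single one_ne_zero)
  refine ⟨h0, ?_⟩
  have hne : u tt ≠ 0 := by rw [Ne, map_eq_zero]; exact tt_ne_zero
  apply Oh_cancel hne (u_tt_order H)
  have e : u tt * (u tt⁻¹ - ev r v (TT p (dD k) tt⁻¹)) =
    ev r v (TT p (dD k) (tt * tt⁻¹) - TT p (dD k) tt * TT p (dD k) tt⁻¹) := by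
    rw [mul_sub, ← map_mul, mul_inv_cancel₀ tt_ne_zero, u_tt (p := p) H, ← map_mul, map_sub,
      ev_TT_const _ (d_one _ dD_mul), map_one, map_one]
  rw [e]
  have := H.Oh_ev p ((wt_TT p (Oh_tt.mul h0)).sub ((wt_TT p Oh_tt).mul (wt_TT p h0)))
    (TT_mul p _ dD_mul _ _)
  exact this.mono (by linarith)

theorem TE_single_one (H : Setup r u v) (j : ℤ) : TE p r u v j (HahnSeries.single j 1) := by
  induction j using Int.induction_on with
  | zero => exact TE_const H 1
  | succ i ih =>
    have := ih.mul H (TE_tt H)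
    rwa [tt, HahnSeries.single_mul_single, one_mul] at this
  | pred i ih =>
    have := ih.mul H (TE_tt_inv H)
    rw [tt, HahnSeries.inv_single, HahnSeries.single_mul_single, inv_one, one_mul] at this
    exact this

theorem TE_single (H : Setup r u v) (j : ℤ) (c : k) : TE p r u v j (HahnSeries.single j c) := by
  have := (TE_const (p := p) H c).mul H (TE_single_one H j)
  simpa [HahnSeries.single_mul_single] using this

theorem taylor (H : Setup r u v) {N : ℤ} {x : LaurentSeries k} (hx : Oh N x) :
    Oh (N + p * r) (u x - ev r v (TT p (dD k) x)) := by
  obtain ⟨M, hM⟩ := H.hu_cont (N + p * r)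
  set B := max M (N + p * r) with hB
  set y := x - ∑ j ∈ Finset.Ico N B, HahnSeries.single j (x.coeff j) with hy
  have hyB : Oh B y := by
    intro i hi
    rw [hy, HahnSeries.coeff_sub, HahnSeries.coeff_sum]
    by_cases hiN : i < N
    · rw [hx i hiN, Finset.sum_eq_zero, sub_zero]
      intro j hj
      have := Finset.mem_Ico.1 hj
      exact HahnSeries.coeff_single_of_ne (by omega)
    · rw [Finset.sum_eq_single i]
      · simp
      · intro j _ hj
        exact HahnSeries.coeff_single_of_ne hj.symm
      · intro h; exact absurd (Finset.mem_Ico.2 ⟨by omega, hi⟩) h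
  have hxy : x = y + ∑ j ∈ Finset.Ico N B, HahnSeries.single j (x.coeff j) := by rw [hy]; ring
  let D : LaurentSeries k →+ LaurentSeries (RatFunc k) :=
    AddMonoidHom.mk' (fun x => u x - ev r v (TT p (dD k) x)) (fun a b => by
      simp only [TT_add, map_add]; ring)
  change Oh (N + p * r) (D x)
  rw [hxy, map_add, map_sum]
  refine Oh.add ?_ (Oh.sum _ ?_)
  · change Oh (N + p * r) (u y - ev r v (TT p (dD k) y))
    refine Oh.sub (ordGe_iff.1 (hM y (ordGe_iff.2 (hyB.mono (le_max_left _ _))))) ?_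
    exact (H.Oh_ev0 (wt_TT p hyB)).mono (le_max_right _ _)
  · intro j hj
    have := Finset.mem_Ico.1 hj
    exact (TE_single (p := p) H j (x.coeff j)).2.mono (by omega)

theorem Setup.Oh_u (H : Setup r u v) (p : ℕ) [Fact p.Prime] [CharP k p]
    {N : ℤ} {x : LaurentSeries k} (hx : Oh N x) : Oh N (u x) :=
  TE.ou (p := p) H ⟨hx, taylor H hx⟩

/-- `u x - v x` up to the error term -/
theorem taylor_sub (H : Setup r u v) {N : ℤ} {x : LaurentSeries k} (hx : Oh N x) :
    Oh (N + p * r) (u x - v x - ev r v (AA p (dD k) (dD k x))) := by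
  rw [← TT_sub_C, map_sub, ev_C]
  have := taylor (p := p) H hx
  rwa [sub_sub_sub_cancel_right]

end Setup

end PartP3

section PartP4
open Polynomial WittVector

section WittGeneral
variable {p : ℕ} [hpf : Fact p.Prime] {R : Type*} [CommRing R]

theorem witt_decomp (x : WittVector p R) :
    x = teichmuller p (x.coeff 0) + verschiebung (x.shift 1) := by
  ext n
  rw [coeff_add_of_disjoint]
  · cases n with
    | zero => simp
    | succ n => rw [teichmuller_coeff_pos _ _ _ (by omega), verschiebung_coeff_succ, shift_coeff,
        zero_add, add_comm]
  · intro n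
    cases n with
    | zero => right; simp
    | succ n => left; rw [teichmuller_coeff_pos _ _ _ (by omega)]

theorem teich_mul_coeff [CharP R p] (i : ℕ) (l : R) (w : WittVector p R) :
    (teichmuller p l * w).coeff i = l ^ p ^ i * w.coeff i := by
  induction i generalizing l w with
  | zero => rw [WittVector.mul_coeff_zero, teichmuller_coeff_zero, pow_zero, pow_one]
  | succ i ih =>
    have hF : frobenius (teichmuller p l) = teichmuller p (l ^ p) := by
      ext n
      rw [coeff_frobenius_charP]
      cases n with
      | zero => rw [teichmuller_coeff_zero, teichmuller_coeff_zero]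
      | succ n => rw [teichmuller_coeff_pos _ _ _ (by omega), teichmuller_coeff_pos _ _ _ (by omega),
          zero_pow hpf.out.ne_zero]
    have e : teichmuller p l * w = teichmuller p (l * w.coeff 0) +
        verschiebung (teichmuller p (l ^ p) * w.shift 1) := by
      conv_lhs => rw [witt_decomp w]
      rw [mul_add, map_mul, mul_comm _ (verschiebung _), ← verschiebung_mul_frobenius, hF,
        mul_comm (w.shift 1)]
    rw [e, coeff_add_of_disjoint, teichmuller_coeff_pos _ _ _ (by omega), zero_add,
      verschiebung_coeff_succ, ih, shift_coeff, add_comm 1 i, ← pow_mul, ← pow_succ']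
    intro n
    cases n with
    | zero => right; simp
    | succ n => left; rw [teichmuller_coeff_pos _ _ _ (by omega)]

open Classical in
theorem coeff_select' (P : ℕ → Prop) (x : WittVector p R) (n : ℕ) :
    (select P x).coeff n = if P n then x.coeff n else 0 := by
  simp [select]

theorem sub_tail (x : WittVector p R) (m : ℕ) :
    x - verschiebung^[m] (x.shift m) = init m x := by
  have h : tail m x = verschiebung^[m] (x.shift m) := by
    ext n
    by_cases hn : m ≤ n
    · obtain ⟨j, rfl⟩ := Nat.exists_eq_add_of_le' hn
      rw [iterate_verschiebung_coeff, shift_coeff, tail, coeff_select', if_pos hn, add_comm]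
    · rw [iterate_verschiebung_coeff_eq_zero _ (by omega), tail, coeff_select', if_neg hn]
  rw [← h, sub_eq_iff_eq_add, init_add_tail]

theorem coeff_init (x : WittVector p R) (m i : ℕ) :
    (init m x).coeff i = if i < m then x.coeff i else 0 := by
  rw [init, coeff_select']; split_ifs <;> rfl

theorem lift_sub (S : Subring R) (m : ℕ) (x : WittVector p R) (hx : ∀ i < m, x.coeff i ∈ S) :
    ∃ x' : WittVector p S, init m x = init m (WittVector.map S.subtype x') := by
  classical
  refine ⟨WittVector.mk p (fun i => if h : x.coeff i ∈ S then ⟨x.coeff i, h⟩ else 0), ?_⟩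
  ext i
  rw [coeff_init, coeff_init]
  split_ifs with h
  · rw [map_coeff, coeff_mk, dif_pos (hx i h)]; rfl
  · rfl

theorem witt_sub_mem (S : Subring R) (m : ℕ) (x y : WittVector p R) (hx : ∀ i < m, x.coeff i ∈ S)
    (hy : ∀ i < m, y.coeff i ∈ S) : ∀ i < m, (x - y).coeff i ∈ S := by
  obtain ⟨x', hx'⟩ := lift_sub S m x hx
  obtain ⟨y', hy'⟩ := lift_sub S m y hy
  intro i hi
  have h : init m (x - y) = init m (WittVector.map S.subtype (x' - y')) := by
    rw [init_sub, hx', hy', ← init_sub, map_sub]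
  have h2 := congrArg (fun w => w.coeff i) h
  simp only [coeff_init, if_pos hi, map_coeff] at h2
  rw [h2]
  exact ((x' - y').coeff i).2

end WittGeneral

section Filt
variable {F : Type*} [Field F]

theorem scl_inj (q : ℕ) (hq : 0 < q) : Function.Injective (AddMonoidHom.mulLeft (q : ℤ)) :=
  fun a b h => by
    have : (q : ℤ) ≠ 0 := by omega
    exact mul_left_cancel₀ this h

theorem scl_le (q : ℕ) (hq : 0 < q) (a b : ℤ) :
    AddMonoidHom.mulLeft (q : ℤ) a ≤ AddMonoidHom.mulLeft (q : ℤ) b ↔ a ≤ b := by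
  have : (0 : ℤ) < q := by omega
  exact mul_le_mul_iff_right₀ this

def scl (q : ℕ) (hq : 0 < q) : LaurentSeries F →+* LaurentSeries F :=
  HahnSeries.embDomainRingHom (AddMonoidHom.mulLeft (q : ℤ)) (scl_inj q hq) (scl_le q hq)

theorem Oh_scl (q : ℕ) (hq : 0 < q) (A : ℤ) (x : LaurentSeries F) :
    Oh A (scl q hq x) ↔ (x = 0 ∨ A ≤ q * x.order) := by
  have e : scl q hq x = HahnSeries.embDomain
      (⟨⟨AddMonoidHom.mulLeft (q : ℤ), scl_inj q hq⟩, scl_le q hq _ _⟩ : ℤ ↪o ℤ) x := rfl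
  rw [Oh_iff_orderTop, e, HahnSeries.orderTop_embDomain]
  by_cases hx : x = 0
  · simp [hx]
  · rw [← HahnSeries.order_eq_orderTop_of_ne_zero hx, WithTop.map_coe, WithTop.coe_le_coe]
    simp [hx]

variable (F) in
def intS : Subring (LaurentSeries F) where
  carrier := {x | Oh 0 x}
  mul_mem' := fun ha hb => by simpa using Oh.mul ha hb
  one_mem' := Oh_one
  add_mem' := fun ha hb => Oh.add ha hb
  zero_mem' := Oh.zero 0
  neg_mem' := fun ha => Oh.neg ha

theorem mem_intS (x : LaurentSeries F) : x ∈ intS F ↔ Oh 0 x := Iff.rfl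

variable {p : ℕ} [hpf : Fact p.Prime] [CharP F p]

def Fil (m : ℕ) (N : ℤ) (x : WittVector p (LaurentSeries F)) : Prop :=
  ∀ i < m + 1, x.coeff i = 0 ∨ -N ≤ (p : ℤ) ^ (m - i) * (x.coeff i).order

theorem Fil_iff (m : ℕ) (N : ℤ) (x : WittVector p (LaurentSeries F)) :
    Fil m N x ↔ ∀ i < m + 1, (teichmuller p (HahnSeries.single N 1) *
      WittVector.map (scl (p ^ m) (pow_pos hpf.out.pos m)) x).coeff i ∈ intS F := by
  refine forall₂_congr fun i hi => ?_
  rw [teich_mul_coeff, map_coeff, mem_intS, HahnSeries.single_pow, one_pow]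
  set z := scl (p ^ m) (pow_pos hpf.out.pos m) (x.coeff i) with hz
  have h1 : Oh 0 (HahnSeries.single (p ^ i • N) 1 * z) ↔ Oh (-(p ^ i • N)) z := by
    constructor
    · intro h
      refine Oh_cancel (M := p ^ i • N) (by simp) (HahnSeries.order_single one_ne_zero) (h.mono ?_)
      linarith
    · intro h
      exact (Oh_single _ _).mul' h (by linarith)
  rw [h1, hz, Oh_scl]
  refine or_congr_right ?_
  have hp : (0 : ℤ) < (p : ℤ) ^ i := by exact_mod_cast pow_pos hpf.out.pos i
  have e : ((p ^ m : ℕ) : ℤ) * (x.coeff i).order =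
      (p : ℤ) ^ i * ((p : ℤ) ^ (m - i) * (x.coeff i).order) := by
    rw [← mul_assoc, ← pow_add, Nat.add_sub_cancel' (by omega)]; push_cast; rfl
  have e2 : -(p ^ i • N) = (p : ℤ) ^ i * (-N) := by
    rw [nsmul_eq_mul]; push_cast; ring
  rw [e, e2, mul_le_mul_iff_right₀ hp]

theorem Fil.sub {m : ℕ} {N : ℤ} {x y : WittVector p (LaurentSeries F)} (hx : Fil m N x)
    (hy : Fil m N y) : Fil m N (x - y) := by
  rw [Fil_iff] at *
  rw [map_sub, mul_sub]
  exact witt_sub_mem _ _ _ _ hx hy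

omit [CharP F p] in
theorem Fil.zero (m : ℕ) (N : ℤ) : Fil m N (0 : WittVector p (LaurentSeries F)) :=
  fun i _ => by left; simp

theorem Fil.add {m : ℕ} {N : ℤ} {x y : WittVector p (LaurentSeries F)} (hx : Fil m N x)
    (hy : Fil m N y) : Fil m N (x + y) := by
  have := hx.sub ((Fil.zero m N).sub hy)
  simpa using this

omit [CharP F p] in
theorem Fil.mono {m : ℕ} {N N' : ℤ} {x : WittVector p (LaurentSeries F)} (hx : Fil m N x)
    (h : N ≤ N') : Fil m N' x := fun i hi => by
  rcases hx i hi with h1 | h1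
  · exact Or.inl h1
  · right; linarith

omit [CharP F p] in
theorem Fil.versch {m : ℕ} {N : ℤ} {x : WittVector p (LaurentSeries F)} (hx : Fil m N x) :
    Fil (m + 1) N (verschiebung x) := fun i hi => by
  cases i with
  | zero => left; simp
  | succ i =>
    rw [verschiebung_coeff_succ]
    have := hx i (by omega)
    rwa [Nat.add_sub_add_right]

omit [CharP F p] in
theorem Fil.shift {m : ℕ} {N : ℤ} {x : WittVector p (LaurentSeries F)} (hx : Fil (m + 1) N x) :
    Fil m N (x.shift 1) := fun i hi => by
  rw [shift_coeff]
  have := hx (1 + i) (by omega)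
  rwa [show m + 1 - (1 + i) = m - i by omega] at this

theorem Oh_eval_diff (S : ℤ[X]) {N : ℤ} {a b : LaurentSeries F} (ha : Oh 0 a) (hb : Oh 0 b)
    (hab : Oh N (a - b)) : Oh N (S.eval₂ (Int.castRingHom _) a - S.eval₂ (Int.castRingHom _) b) := by
  induction S using Polynomial.induction_on' with
  | add f g hf hg =>
    rw [eval₂_add, eval₂_add, add_sub_add_comm]; exact hf.add hg
  | monomial n c =>
    rw [eval₂_monomial, eval₂_monomial, ← mul_sub]
    have h : Oh N (a ^ n - b ^ n) := by
      induction n with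
      | zero => simpa using Oh.zero N
      | succ n ih =>
        have e : a ^ (n + 1) - b ^ (n + 1) = (a ^ n - b ^ n) * a + b ^ n * (a - b) := by ring
        rw [e]
        exact (ih.mul' ha (by simp)).add ((hb.pow n).mul' hab (by simp))
    exact (Oh_intCast c).mul' h (by simp)

theorem Oh_eval_int (S : ℤ[X]) {a : LaurentSeries F} (ha : Oh 0 a) :
    Oh 0 (S.eval₂ (Int.castRingHom _) a) := by
  rw [eval₂_eq_sum, Polynomial.sum]
  exact Oh.sum _ fun i _ => (Oh_intCast _).mul' (ha.pow i) (by simp)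

end Filt

end PartP4

section PartP5
open Polynomial WittVector

section Sub
variable {k : Type*} [Field k] {r : ℕ} {u v : LaurentSeries k →+* LaurentSeries (RatFunc k)}
variable {p : ℕ} [hpf : Fact p.Prime] [CharP k p]

instance charPRatFunc : CharP (RatFunc k) p :=
  charP_of_injective_algebraMap (algebraMap k (RatFunc k)).injective p

theorem X_dvd_AA (y : LaurentSeries k) : X ^ 1 ∣ AA p (dD k) y := by
  rw [pow_one, X_dvd_iff, AA_coeff_zero]

theorem X_dvd_eval (S : ℤ[X]) (hS : X ∣ S) {N : ℤ} {a : LaurentSeries (RatFunc k)} (ha : Oh N a)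
    (hN : 0 ≤ N) : Oh N (S.eval₂ (Int.castRingHom _) a) := by
  obtain ⟨Q, rfl⟩ := hS
  rw [eval₂_mul, eval₂_X]
  exact ha.mul' (Oh_eval_int Q (ha.mono hN)) (by simp)

theorem ratio_coeff (f : LaurentSeries (RatFunc k)) (g : LaurentSeries (RatFunc k)) (hg : g ≠ 0)
    (j : ℕ) : (teichmuller p f - teichmuller p g).coeff j =
      g ^ p ^ j * ((SW p).coeff j).eval₂ (Int.castRingHom _) ((f - g) * g⁻¹) := by
  have e : teichmuller p f - teichmuller p g = teichmuller p g *
      WittVector.map (eval₂RingHom (Int.castRingHom _) ((f - g) * g⁻¹)) (SW p) := by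
    rw [SW, map_sub, map_teichmuller, map_one, mul_sub, mul_one, ← map_mul]
    congr 2
    rw [coe_eval₂RingHom, eval₂_add, eval₂_one, eval₂_X]
    field_simp
    ring
  rw [e, teich_mul_coeff, map_coeff, coe_eval₂RingHom]

theorem Oh_u_sub_v (p : ℕ) [hpf : Fact p.Prime] [CharP k p] (H : Setup r u v) {N : ℤ} {x : LaurentSeries k} (hx : Oh N x) :
    Oh (N + r) (u x - v x) := by
  have h1 := taylor_sub (p := p) H hx
  have h2 := H.Oh_ev 1 (wt_AA p hx.deriv) (X_dvd_AA _)
  have hp : (1 : ℤ) ≤ p := by exact_mod_cast hpf.out.pos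
  have h3 := (h1.mono (M := N + r) (by nlinarith [H.hr])).add (h2.mono (M := N + r) (by simp))
  simpa using h3

theorem Oh_vpow (H : Setup r u v) {N : ℤ} {x : LaurentSeries k} (hx : Oh N x) (j : ℕ) :
    Oh ((p : ℤ) ^ j * N) (v x ^ p ^ j) := by
  have := (H.Oh_v hx).pow (p ^ j)
  exact this.mono (by push_cast; linarith)

theorem sub_lemma_i (H : Setup r u v) (M : ℕ) (n : ℤ) (x : LaurentSeries k)
    (hx : x = 0 ∨ -n ≤ (p : ℤ) ^ M * x.order) (j : ℕ) (hj : j < M) :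
    (teichmuller p (u x) - teichmuller p (v x)).coeff j = 0 ∨ 
    -n + p * r ≤ (p : ℤ) ^ (M - j) *
      ((teichmuller p (u x) - teichmuller p (v x)).coeff j).order := by
  by_cases hx0 : x = 0
  · left; simp [hx0]
  rw [or_iff_right hx0] at hx
  have hvx : v x ≠ 0 := by simpa using hx0
  have hvo : Oh (-x.order) (v x)⁻¹ := by
    rw [← map_inv₀]; exact H.Oh_v (Oh_inv hx0 rfl)
  have hy : Oh (r : ℤ) ((u x - v x) * (v x)⁻¹) :=
    (Oh_u_sub_v p H (Oh_order x)).mul' hvo (by linarith)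
  have h := (Oh_vpow (p := p) H (Oh_order x) j).mul (X_dvd_eval _ (SW_zero p j) hy (by positivity))
  rw [← ratio_coeff (p := p) _ _ hvx, Oh_iff_order] at h
  refine h.imp_right fun h => ?_
  have hp : (1 : ℤ) ≤ p := by exact_mod_cast hpf.out.pos
  have h2 := mul_le_mul_of_nonneg_left h (show (0 : ℤ) ≤ (p : ℤ) ^ (M - j) by positivity)
  rw [mul_add, ← mul_assoc, ← pow_add, Nat.sub_add_cancel hj.le] at h2
  have h3 : (p : ℤ) ≤ (p : ℤ) ^ (M - j) := le_self_pow₀ hp (by omega)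
  have h4 : (p : ℤ) * r ≤ (p : ℤ) ^ (M - j) * r := mul_le_mul_of_nonneg_right h3 (by positivity)
  linarith

theorem eval_ev (S : ℤ[X]) (P : (LaurentSeries k)[X]) :
    S.eval₂ (Int.castRingHom _) (ev r v P) =
      ev r v ((S.map (Int.castRingHom (LaurentSeries k))).comp P) := by
  rw [comp, eval₂_map, hom_eval₂]
  congr 1
  exact RingHom.ext_int _ _

theorem sub_lemma_ii (H : Setup r u v) (M : ℕ) (hM : M ≠ 0) (n : ℤ) (x : LaurentSeries k)
    (hx : x = 0 ∨ -n ≤ (p : ℤ) ^ M * x.order) :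
    Oh (-n + p * r) ((teichmuller p (u x) - teichmuller p (v x)).coeff M -
      ev r v (AA p (dD k) (x ^ (p ^ M - 1) * dD k x))) := by
  by_cases hx0 : x = 0
  · subst hx0
    simpa [AA_zero] using Oh.zero _
  rw [or_iff_right hx0] at hx
  have hvx : v x ≠ 0 := by simpa using hx0
  have hxi : Oh (-x.order) x⁻¹ := Oh_inv hx0 rfl
  have hvo : Oh (-x.order) (v x)⁻¹ := by
    rw [← map_inv₀]; exact H.Oh_v hxi
  have hy : Oh (r : ℤ) ((u x - v x) * (v x)⁻¹) :=
    (Oh_u_sub_v p H (Oh_order x)).mul' hvo (by linarith)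
  have hy0 : Oh 0 ((u x - v x) * (v x)⁻¹) := hy.mono (by positivity)
  set P : (LaurentSeries k)[X] := C x⁻¹ * TT p (dD k) x - 1 with hP
  have hPw : wt 0 P := by
    have := (wt_C hxi).mul (wt_TT p (Oh_order x))
    rw [neg_add_cancel] at this
    exact this.sub wt_one
  have hP0 : Oh 0 (ev r v P) := H.Oh_ev0 hPw
  have hd : Oh ((p : ℤ) * r) ((u x - v x) * (v x)⁻¹ - ev r v P) := by
    have e : (u x - v x) * (v x)⁻¹ - ev r v P = (v x)⁻¹ * (u x - ev r v (TT p (dD k) x)) := by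
      rw [hP, map_sub, map_mul, ev_C, map_one, map_inv₀]
      field_simp
      ring
    rw [e]
    exact hvo.mul' (taylor (p := p) H (Oh_order x)) (by linarith)
  have h1 := Oh_eval_diff ((SW p).coeff M) hy0 hP0 hd
  rw [eval_ev] at h1
  have hS0 : (((SW p).coeff M).map (Int.castRingHom (LaurentSeries k))).coeff 0 = 0 := by
    rw [coeff_map, X_dvd_iff.1 (SW_zero p M), map_zero]
  have hlog := log_lemma p (dD k) dD_mul _ hS0 (SW_deriv p (LaurentSeries k) M hM) x hx0
  have hwl : wt 0 (((SW p).coeff M).map (Int.castRingHom (LaurentSeries k))|>.comp P) := 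
    wt.comp_int _ hPw
  have hwA : wt 0 (AA p (dD k) (x⁻¹ * dD k x)) := 
    wt_AA p (hxi.mul' (Oh_order x).deriv (by linarith))
  have h2 := H.Oh_ev p (hwl.sub hwA) hlog
  rw [map_sub, zero_add] at h2
  have h3 := h1.add h2
  rw [sub_add_sub_cancel] at h3
  have h4 := (Oh_vpow (p := p) H (Oh_order x) M).mul h3
  rw [mul_sub, ← ratio_coeff (p := p) _ _ hvx] at h4
  have e : v x ^ p ^ M * ev r v (AA p (dD k) (x⁻¹ * dD k x)) =
      ev r v (AA p (dD k) (x ^ (p ^ M - 1) * dD k x)) := by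
    have e0 : x ^ p ^ M * (x⁻¹ * dD k x) = x ^ (p ^ M - 1) * dD k x := by
      have e1 : x ^ p ^ M = x ^ (p ^ M - 1) * x := by
        rw [← pow_succ, Nat.sub_add_cancel (Nat.one_le_pow _ _ hpf.out.pos)]
      rw [e1, mul_assoc, mul_inv_cancel_left₀ hx0]
    rw [← map_pow, ← ev_C (r := r) (v := v), ← map_mul,
      ← AA_const_mul p (dD k) dD_mul _ _ (d_pow_p p (dD k) dD_mul x M hM), e0]
  rw [e] at h4
  exact h4.mono (by linarith)

end Sub

end PartP5

section PartP6
open Polynomial WittVector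

section Alg
variable {p : ℕ} [hpf : Fact p.Prime] {R : Type*} [CommRing R]

theorem iterV_add (m : ℕ) (x y : WittVector p R) :
    verschiebung^[m] (x + y) = verschiebung^[m] x + verschiebung^[m] y := by
  induction m with
  | zero => rfl
  | succ m ih => simp only [Function.iterate_succ_apply', ih, map_add]

theorem alg_step (m : ℕ) (X s w D : WittVector p R) :
    X + verschiebung D - verschiebung^[m + 1] (s + w) =
      (X - verschiebung^[m + 1] s) + verschiebung (D - verschiebung^[m] w) := by
  rw [iterV_add, map_sub, Function.iterate_succ_apply' _ m w]
  abel

theorem sub_coeff_zero' (x y : WittVector p R) : (x - y).coeff 0 = x.coeff 0 - y.coeff 0 :=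
  map_sub WittVector.constantCoeff x y

theorem sub_decomp {S : Type*} [CommRing S] (u v : R →+* S) (a : WittVector p R) :
    WittVector.map u a - WittVector.map v a =
      (teichmuller p (u (a.coeff 0)) - teichmuller p (v (a.coeff 0))) +
        verschiebung (WittVector.map u (a.shift 1) - WittVector.map v (a.shift 1)) := by
  conv_lhs => rw [witt_decomp a]
  rw [map_add, map_add, map_teichmuller, map_teichmuller, map_verschiebung, map_verschiebung,
    map_sub]
  abel

end Alg

section MainL
variable {k : Type*} [Field k] {r : ℕ} {u v : LaurentSeries k →+* LaurentSeries (RatFunc k)}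
variable {p : ℕ} [hpf : Fact p.Prime] [CharP k p]

theorem main_lemma (H : Setup r u v) (m : ℕ) (n : ℤ) (a : WittVector p (LaurentSeries k))
    (ha : Fil m n a) : ∃ w : WittVector p (LaurentSeries (RatFunc k)),
    Oh (-n + p * r) (w.coeff 0 - ev r v (AA p (dD k)
      (∑ i ∈ Finset.range (m + 1), a.coeff i ^ (p ^ (m - i) - 1) * dD k (a.coeff i)))) ∧
    Fil m (n - p * r) (WittVector.map u a - WittVector.map v a - verschiebung^[m] w) := by
  induction m generalizing a with
  | zero =>
    refine ⟨WittVector.map u a - WittVector.map v a, ?_, ?_⟩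
    · have h0 : Oh (-n) (a.coeff 0) := by
        rw [Oh_iff_order]; simpa using ha 0 (by omega)
      have := taylor_sub (p := p) H h0
      simpa [sub_coeff_zero'] using this
    · rw [Function.iterate_zero, id, sub_self]; exact Fil.zero _ _
  | succ m ih =>
    obtain ⟨w', h1, h2⟩ := ih (a.shift 1) ha.shift
    set X := teichmuller p (u (a.coeff 0)) - teichmuller p (v (a.coeff 0)) with hX
    have hx := ha 0 (by omega)
    rw [Nat.sub_zero] at hx
    have hD : WittVector.map u a - WittVector.map v a =
        X + verschiebung (WittVector.map u (a.shift 1) - WittVector.map v (a.shift 1)) := 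
      sub_decomp u v a
    refine ⟨X.shift (m + 1) + w', ?_, ?_⟩
    · rw [WittVector.add_coeff_zero, shift_coeff, add_zero, Finset.sum_range_succ', AA_add, map_add]
      have h3 := sub_lemma_ii H (m + 1) (by omega) n (a.coeff 0) hx
      have h4 := h1.add h3
      refine cast (congrArg (Oh _) ?_) h4
      simp only [shift_coeff, Nat.add_sub_add_right, Nat.sub_zero, add_comm 1]
      abel
    · have e : WittVector.map u a - WittVector.map v a - verschiebung^[m + 1] (X.shift (m + 1) + w')
          = init (m + 1) X + verschiebung (WittVector.map u (a.shift 1) -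
            WittVector.map v (a.shift 1) - verschiebung^[m] w') := by
        rw [hD, alg_step, sub_tail]
      rw [e]
      refine Fil.add ?_ h2.versch
      intro i hi
      rw [coeff_init]
      split_ifs with h
      · have := sub_lemma_i H (m + 1) n (a.coeff 0) hx i h
        refine this.imp_right fun h => ?_
        linarith
      · left; rfl

end MainL

section Trunc
variable {F : Type*} [Field F] {p : ℕ} [hpf : Fact p.Prime] [CharP F p]

theorem inFil_truncate (m : ℕ) (N : ℤ) (x : WittVector p (LaurentSeries F)) :
    inFil p N (WittVector.truncate (m + 1) x) ↔ Fil m N x := by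
  constructor
  · intro h i hi
    simpa using h ⟨i, hi⟩
  · intro h i
    simpa using h i i.2

theorem truncate_V (m : ℕ) (w : WittVector p (LaurentSeries F)) :
    WittVector.truncate (m + 1) (verschiebung^[m] w) = Vm p (w.coeff 0) := by
  refine TruncatedWittVector.ext fun i => ?_
  rw [coeff_truncate, Vm, TruncatedWittVector.coeff_mk]
  split_ifs with h
  · rw [h]; simpa using iterate_verschiebung_coeff w m 0
  · exact iterate_verschiebung_coeff_eq_zero _ (by have := i.2; omega)

theorem Vm_add (m : ℕ) (x y : LaurentSeries F) :
    (Vm p (x + y) : TruncatedWittVector p (m + 1) (LaurentSeries F)) = Vm p x + Vm p y := by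
  have h := truncate_V m (teichmuller p x + teichmuller p y)
  rw [WittVector.add_coeff_zero, teichmuller_coeff_zero, teichmuller_coeff_zero] at h
  rw [← h, iterV_add, map_add, truncate_V, truncate_V, teichmuller_coeff_zero,
    teichmuller_coeff_zero]

theorem inFil_Vm (m : ℕ) (N : ℤ) (x : LaurentSeries F) (hx : Oh (-N) x) :
    inFil p N (Vm p x : TruncatedWittVector p (m + 1) (LaurentSeries F)) := by
  intro i
  rw [Vm, TruncatedWittVector.coeff_mk]
  split_ifs with h
  · rw [h, Nat.sub_self, pow_zero, one_mul, ← Oh_iff_order]; exact hx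
  · left; rfl

theorem inFil.add {m : ℕ} {N : ℤ} {x y : TruncatedWittVector p (m + 1) (LaurentSeries F)}
    (hx : inFil p N x) (hy : inFil p N y) : inFil p N (x + y) := by
  obtain ⟨x, rfl⟩ := WittVector.truncate_surjective p (m + 1) (LaurentSeries F) x
  obtain ⟨y, rfl⟩ := WittVector.truncate_surjective p (m + 1) (LaurentSeries F) y
  rw [inFil_truncate] at hx hy
  rw [← map_add, inFil_truncate]
  exact hx.add hy

theorem inFil.mono {m : ℕ} {N N' : ℤ} {x : TruncatedWittVector p (m + 1) (LaurentSeries F)}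
    (hx : inFil p N x) (h : N ≤ N') : inFil p N' x := fun i => (hx i).imp_right fun h1 => by linarith

theorem mapTW_truncate {k : Type*} [Field k] (u : LaurentSeries k →+* LaurentSeries F) (m : ℕ)
    (a : WittVector p (LaurentSeries k)) :
    mapTW p u (WittVector.truncate (m + 1) a) = WittVector.truncate (m + 1) (WittVector.map u a) := by
  refine TruncatedWittVector.ext fun i => ?_
  rw [mapTW, TruncatedWittVector.coeff_mk, coeff_truncate, coeff_truncate, map_coeff]

end Trunc

section MainT
variable {k : Type*} [Field k] {r : ℕ} {u v : LaurentSeries k →+* LaurentSeries (RatFunc k)}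
variable {p : ℕ} [hpf : Fact p.Prime] [CharP k p]

theorem main_trunc (H : Setup r u v) (m : ℕ) (n : ℤ)
    (a : TruncatedWittVector p (m + 1) (LaurentSeries k))
    (ha : inFil p n a) : ∃ w : LaurentSeries (RatFunc k),
    Oh (-n + p * r) (w - ev r v (AA p (dD k) (alphaW p a))) ∧
    inFil p (n - p * r) (mapTW p u a - mapTW p v a - Vm p w) := by
  obtain ⟨a, rfl⟩ := WittVector.truncate_surjective p (m + 1) (LaurentSeries k) a
  rw [inFil_truncate] at ha
  obtain ⟨w, h1, h2⟩ := main_lemma H m n a ha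
  refine ⟨w.coeff 0, ?_, ?_⟩
  · have e : alphaW p (WittVector.truncate (m + 1) a) = 
      ∑ i ∈ Finset.range (m + 1), a.coeff i ^ (p ^ (m - i) - 1) * dD k (a.coeff i) := by
      rw [alphaW, Finset.sum_range]
      simp only [coeff_truncate]; rfl
    rw [e]; exact h1
  · rw [mapTW_truncate, mapTW_truncate, ← truncate_V, ← map_sub, ← map_sub, inFil_truncate]
    exact h2

end MainT

end PartP6

section PartP7
open Polynomial

section Est
variable {k : Type*} [Field k] {r : ℕ} {u v : LaurentSeries k →+* LaurentSeries (RatFunc k)}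

theorem comm_est {γ η : ℤ} (c y : LaurentSeries k) (hc : Oh γ (dD k c)) (hy : Oh η y) (s : ℕ) :
    Oh (γ + η - s + 1) (c * (dD k)^[s] y - (dD k)^[s] (c * y)) := by
  induction s with
  | zero => simpa using Oh.zero _
  | succ s ih =>
    have e : c * (dD k)^[s + 1] y - (dD k)^[s + 1] (c * y) =
        dD k (c * (dD k)^[s] y - (dD k)^[s] (c * y)) - (dD k)^[s] y * dD k c := by
      rw [Function.iterate_succ_apply', Function.iterate_succ_apply', map_sub, dD_mul]
      ring
    rw [e]
    refine (ih.deriv.mono ?_).sub ((hy.iter s).mul' hc ?_) <;> push_cast <;> linarith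

variable {p : ℕ} [hpf : Fact p.Prime] [CharP k p]

theorem Q_est (H : Setup r u v) (hp2 : 2 < p) {γ η : ℤ} (c y : LaurentSeries k)
    (hc : Oh γ (dD k c)) (hy : Oh η y) :
    Oh (γ + η + 2 + 3 * r) (ev r v (C c * AA p (dD k) y - AA p (dD k) (c * y) +
      C (2⁻¹ * (y * dD k c)) * X ^ 2)) := by
  have hcs : ∀ s : ℕ, (C c * AA p (dD k) y - AA p (dD k) (c * y)).coeff (s + 1) =
      if s < p - 1 then (((s + 1).factorial : ℕ) : LaurentSeries k)⁻¹ *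
        (c * (dD k)^[s] y - (dD k)^[s] (c * y)) else 0 := by
    intro s
    rw [coeff_sub, coeff_C_mul, AA_coeff_succ, AA_coeff_succ]
    split_ifs
    · ring
    · ring
  have h2 : (C c * AA p (dD k) y - AA p (dD k) (c * y) +
      C (2⁻¹ * (y * dD k c)) * X ^ 2).coeff 2 = 0 := by
    rw [coeff_add, hcs 1, if_pos (by omega), coeff_C_mul, coeff_X_pow, if_pos rfl]
    simp only [Function.iterate_one, dD_mul]
    simp only [Nat.factorial, Nat.reduceAdd, Nat.reduceMul, Nat.cast_ofNat, Nat.succ_eq_add_one]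
    ring
  have hdvd : X ^ 3 ∣ C c * AA p (dD k) y - AA p (dD k) (c * y) +
      C (2⁻¹ * (y * dD k c)) * X ^ 2 := by
    rw [X_pow_dvd_iff]
    intro i hi
    interval_cases i
    · rw [coeff_add, coeff_sub, coeff_C_mul, AA_coeff_zero, AA_coeff_zero, coeff_C_mul, coeff_X_pow]
      simp
    · rw [coeff_add, hcs 0, coeff_C_mul, coeff_X_pow]
      simp
    · exact h2
  have hw : wt (γ + η + 2) (C c * AA p (dD k) y - AA p (dD k) (c * y) +
      C (2⁻¹ * (y * dD k c)) * X ^ 2) := by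
    intro s
    by_cases hs : s < 3
    · rw [X_pow_dvd_iff.1 hdvd s hs]; exact Oh.zero _
    · obtain ⟨s, rfl⟩ : ∃ s', s = s' + 1 := ⟨s - 1, by omega⟩
      rw [coeff_add, hcs, coeff_C_mul, coeff_X_pow, if_neg (show ¬ s + 1 = 2 by omega), mul_zero, add_zero]
      split_ifs
      · exact (Oh_natCast_inv _).mul' (comm_est c y hc hy s) (by push_cast; linarith)
      · exact Oh.zero _
  exact_mod_cast H.Oh_ev 3 hw hdvd

theorem ev_CX2 (H : Setup r u v) {N : ℤ} {x : LaurentSeries k} (hx : Oh N x) :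
    Oh (N + 2 * r + 2) (ev r v (C x * X ^ 2)) := by
  rw [map_mul, map_pow, ev_C, ev_X]
  exact (H.Oh_v hx).mul' ((Oh_hh r).pow 2) (by push_cast; linarith)

theorem Oh_two_inv : Oh 0 ((2 : LaurentSeries k)⁻¹) := by
  exact_mod_cast Oh_natCast_inv (F := k) 2

theorem main_term (H : Setup r u v) (α c : LaurentSeries k) :
    v ((2 : LaurentSeries k)⁻¹ * tt ^ 2 * α * lsDeriv c / c) *
          (tt : LaurentSeries (RatFunc k)) ^ (2 * r) * θθ k ^ 2 =
    ev r v (C (2⁻¹ * α * (dD k c * c⁻¹)) * X ^ 2) := by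
  rw [map_mul, map_pow, ev_C, ev_X, ← dD_apply]
  have e : (2 : LaurentSeries k)⁻¹ * tt ^ 2 * α * dD k c / c =
    tt ^ 2 * (2⁻¹ * α * (dD k c * c⁻¹)) := by ring
  rw [e, map_mul, map_pow, v_tt H, hh]
  ring

theorem estimate (H : Setup r u v) (hp2 : 2 < p) {γ β n νb νc : ℤ}
    (α b c : LaurentSeries k) (w : LaurentSeries (RatFunc k)) (hc0 : c ≠ 0)
    (hc : Oh γ c) (hb : Oh β b) (hc' : Oh (γ + νc - 1) (dD k c)) (hb' : Oh (β + νb - 1) (dD k b))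
    (hcc : Oh (νc - 1) (dD k c * c⁻¹)) (hsum : -n ≤ γ + β + νb) (hνb : 0 ≤ νb) (hνc : 0 ≤ νc)
    (hcond : νb + νc < ((p : ℤ) - 2) * (r : ℤ))
    (hw : Oh (-n + p * r) (w - ev r v (AA p (dD k) α)))
    (hε : Oh (-n + νc + r) (α + c * dD k b)) :
    Oh (-n + νc + 2 * r + 1) (w + v c * (u b - v b) -
      ev r v (C (2⁻¹ * α * (dD k c * c⁻¹)) * X ^ 2)) := by
  have hr := H.hr
  have hr' : (1 : ℤ) ≤ r := by exact_mod_cast hr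
  have e : w + v c * (u b - v b) - ev r v (C (2⁻¹ * α * (dD k c * c⁻¹)) * X ^ 2) =
      (w - ev r v (AA p (dD k) α)) + v c * (u b - v b - ev r v (AA p (dD k) (dD k b))) +
      ev r v (AA p (dD k) (α + c * dD k b)) +
      ev r v (C c * AA p (dD k) (dD k b) - AA p (dD k) (c * dD k b) +
        C (2⁻¹ * (dD k b * dD k c)) * X ^ 2) -
      ev r v (C (2⁻¹ * ((dD k c * c⁻¹) * (α + c * dD k b))) * X ^ 2) := by
    have e2 : (2 : LaurentSeries k)⁻¹ * ((dD k c * c⁻¹) * (α + c * dD k b)) =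
        2⁻¹ * α * (dD k c * c⁻¹) + 2⁻¹ * (dD k b * dD k c) := by
      field_simp
    rw [e2, AA_add]
    simp only [map_add, map_sub, map_mul, ev_C]
    ring
  rw [e]
  have t1 := taylor_sub (p := p) H hb
  have t2 : Oh (-n + νc + 2 * r + 1) (v c * (u b - v b - ev r v (AA p (dD k) (dD k b)))) :=
    (H.Oh_v hc).mul' t1 (by linarith)
  have t3 := H.Oh_ev 1 (wt_AA p (w := -n + νc + r + 1) (hε.mono (by linarith))) (X_dvd_AA _)
  have t4 := Q_est (p := p) H hp2 c (dD k b) hc' hb'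
  have t5 := ev_CX2 H (Oh_two_inv.mul' (hcc.mul hε) (P := νc - 1 + (-n + νc + r)) (by linarith))
  refine ((((hw.mono ?_).add t2).add (t3.mono ?_)).add (t4.mono ?_)).sub (t5.mono ?_)
  · linarith
  · push_cast; linarith
  · linarith
  · linarith

end Est

end PartP7

/-- Let `a ∈ fil_n W_{m+1}(K)`, `α = α(a)`, and let `b, c ∈ K^×`
with `b' ≠ 0`, `c' ≠ 0`; set `ν(b) = ord(t·b'/b)`, `ν(c) = ord(t·c'/c)`.
Assume `ord(t·α) = −n`, `ord(α + c·b') ≥ −n + ν(c) + r` (with `ord 0 = +∞`)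
and `ν(b) + ν(c) < (p−2)·r`. Then
`E = W_{m+1}(u)(a) − W_{m+1}(v)(a) + V^m(v(c)·(u(b) − v(b)))` lies in
`fil_{n−ν(c)−2r} W_{m+1}(L)`, and
`E − V^m(v((1/2)·t²·α·c'/c)·t^{2r}·θ²)` lies in `fil_{n−ν(c)−2r−1} W_{m+1}(L)`. -/
theorem statement9 (p : ℕ) [Fact p.Prime] (hp2 : 2 < p)
    (k : Type*) [Field k] [PerfectField k] [CharP k p]
    (r : ℕ) (hr : 1 ≤ r)
    (u v : LaurentSeries k →+* LaurentSeries (RatFunc k))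
    (hv : ∀ (x : LaurentSeries k) (j : ℤ),
      (v x).coeff j = algebraMap k (RatFunc k) (x.coeff j))
    (hu_alg : ∀ c : k,
      u (HahnSeries.single 0 c) = HahnSeries.single 0 (algebraMap k (RatFunc k) c))
    (hu_t : u tt = tt * (1 + tt ^ r * θθ k))
    (hu_cont : ∀ N : ℤ, ∃ M : ℤ, ∀ x : LaurentSeries k, ordGe x M → ordGe (u x) N)
    (m : ℕ) (n : ℤ)
    (a : TruncatedWittVector p (m + 1) (LaurentSeries k))
    (ha : inFil p n a)
    (b c : LaurentSeries k) (hb : b ≠ 0) (hc : c ≠ 0)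
    (hb' : lsDeriv b ≠ 0) (hc' : lsDeriv c ≠ 0)
    (νb νc : ℤ)
    (hνb : (tt * lsDeriv b / b).order = νb)
    (hνc : (tt * lsDeriv c / c).order = νc)
    (hα : alphaW p a ≠ 0)
    (hordα : (tt * alphaW p a).order = -n)
    (hcb : ordGe (alphaW p a + c * lsDeriv b) (-n + νc + r))
    (hcond : νb + νc < ((p : ℤ) - 2) * (r : ℤ)) :
    inFil p (n - νc - 2 * r)
      (mapTW p u a - mapTW p v a + Vm p (v c * (u b - v b))) ∧
    inFil p (n - νc - 2 * r - 1)
      (mapTW p u a - mapTW p v a + Vm p (v c * (u b - v b)) -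
        Vm p (v ((2 : LaurentSeries k)⁻¹ * tt ^ 2 * alphaW p a * lsDeriv c / c) *
          (tt : LaurentSeries (RatFunc k)) ^ (2 * r) * θθ k ^ 2)) := by
  have H : Setup r u v := ⟨hr, hv, hu_alg, hu_t, hu_cont⟩
  have hr' : (1 : ℤ) ≤ r := by exact_mod_cast hr
  set α := alphaW p a with hαdef
  rw [ordGe_iff] at hcb
  have ht1 : (tt : LaurentSeries k).order = 1 := HahnSeries.order_single one_ne_zero
  have ht0 : (tt : LaurentSeries k) ≠ 0 := tt_ne_zero
  have hν : ∀ (x : LaurentSeries k) (ν : ℤ), x ≠ 0 → lsDeriv x ≠ 0 →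
      (tt * lsDeriv x / x).order = ν → (dD k x).order = x.order + ν - 1 ∧ 0 ≤ ν := by
    intro x ν hx hx' h
    have h0 : tt * lsDeriv x / x ≠ 0 := div_ne_zero (mul_ne_zero ht0 hx') hx
    have h1 := HahnSeries.order_mul h0 hx
    rw [div_mul_cancel₀ _ hx, HahnSeries.order_mul ht0 hx', ht1, h] at h1
    have h2 := (Oh_order x).deriv
    rw [Oh_iff_order, dD_apply, or_iff_right hx'] at h2
    rw [dD_apply]
    constructor <;> linarith
  obtain ⟨hoc, hνc0⟩ := hν c νc hc hc' hνc
  obtain ⟨hob, hνb0⟩ := hν b νb hb hb' hνb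
  have hoα : α.order = -n - 1 := by
    rw [HahnSeries.order_mul ht0 hα, ht1] at hordα
    linarith
  have hα1 : Oh (-n - 1) α := hoα ▸ Oh_order α
  have hcb1 : Oh (-n - 1) (c * lsDeriv b) := by
    have := (hcb.mono (M := -n - 1) (by linarith)).sub hα1
    rwa [add_sub_cancel_left] at this
  have hsum : -n ≤ c.order + b.order + νb := by
    rw [Oh_iff_order, or_iff_right (mul_ne_zero hc hb'), HahnSeries.order_mul hc hb'] at hcb1
    rw [dD_apply] at hob
    linarith
  have hcc : Oh (νc - 1) (dD k c * c⁻¹) :=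
    (Oh_order (dD k c)).mul' (Oh_inv hc rfl) (by linarith)
  obtain ⟨w, hw1, hw2⟩ := main_trunc H m n a ha
  have hest := estimate H hp2 α b c w hc (Oh_order c) (Oh_order b) (hoc ▸ Oh_order (dD k c))
    (hob ▸ Oh_order (dD k b)) hcc hsum hνb0 hνc0 hcond hw1 hcb
  have hmain : Oh (-n + νc + 2 * r) (ev r v (Polynomial.C (2⁻¹ * α * (dD k c * c⁻¹)) * Polynomial.X ^ 2)) :=
    (ev_CX2 H ((Oh_two_inv.mul hα1).mul hcc)).mono (by linarith)
  rw [main_term H]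
  set Mt := ev r v (Polynomial.C (2⁻¹ * α * (dD k c * c⁻¹)) * Polynomial.X ^ 2) with hMt
  set z := w + v c * (u b - v b) - Mt with hz
  have eV : (Vm p w + Vm p (v c * (u b - v b)) : TruncatedWittVector p (m + 1) _) =
      Vm p z + Vm p Mt := by
    rw [← Vm_add, ← Vm_add, hz, sub_add_cancel]
  have e : mapTW p u a - mapTW p v a + Vm p (v c * (u b - v b)) =
      (mapTW p u a - mapTW p v a - Vm p w) + Vm p z + Vm p Mt := by
    rw [add_assoc, ← eV]; abel
  have hA : inFil p (n - νc - 2 * r - 1) ((mapTW p u a - mapTW p v a - Vm p w) + Vm p z) :=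
    (hw2.mono (by linarith)).add (inFil_Vm m _ z (hest.mono (by linarith)))
  rw [e]
  refine ⟨(hA.mono (by linarith)).add (inFil_Vm m _ Mt (hmain.mono (by linarith))), ?_⟩
  rw [add_sub_cancel_right]
  exact hA

end LFT
end
end

section
/- Let α, b, c ∈ K be nonzero with b' ≠ 0 and c' ≠ 0. Put n = −ord(t·α), ν(b) = ord(t·b'/b) and ν(c) = ord(t·c'/c). Assume 2·ord(α + c·b') ≥ −n + ν(c), 2·ν(b) + p·ν(c) < (p−2)·n, and that n − ν(c) is odd. Then the element (1/2)·t^{n+2−ν(c)}·α·c'/c of K has ord equal to 0, so it lies in k[[t]] with nonzero constant coefficient γ ∈ k^×; and −t·c'/(2·b')·γ^{−1} is a square in K^×. -/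
/-!
Setting: `p > 2` a prime, `k` a perfect field of characteristic `p`,
`K = k((t))` the field of formal Laurent series, `ord` the `t`-adic valuation
(with `ord 0 = +∞`, encoded below via the predicate `ordGe`),
`L = k(θ)((t))` with `k(θ) = RatFunc k`.
-/

noncomputable section

namespace LFT

variable {F : Type*} [Field F]

lemma isSq_of_one_unit {k : Type*} [Field k] (h2 : (2 : k) ≠ 0) (x : LaurentSeries k)
    (h0 : x.order = 0) (h1 : x.coeff 0 = 1) : ∃ s : LaurentSeries k, s ≠ 0 ∧ x = s ^ 2 := by
  have hx : x ≠ 0 := by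
    rintro rfl
    simp at h1
  set f : PowerSeries k := LaurentSeries.powerSeriesPart x with hf
  have hfx : HahnSeries.ofPowerSeries ℤ k f = x := by
    rw [hf, LaurentSeries.ofPowerSeries_powerSeriesPart, h0]
    simp
  have hf0 : PowerSeries.constantCoeff f = 1 := by
    rw [← PowerSeries.coeff_zero_eq_constantCoeff_apply, hf,
      LaurentSeries.powerSeriesPart_coeff, h0]
    simpa using h1
  have hH : HenselianRing (PowerSeries k) (Ideal.span {PowerSeries.X}) := inferInstance
  obtain ⟨a, ha, -⟩ := hH.is_henselian (Polynomial.X ^ 2 - Polynomial.C f)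
    (Polynomial.monic_X_pow_sub_C f two_ne_zero) 1
    (by
      rw [Ideal.mem_span_singleton, PowerSeries.X_dvd_iff]
      simp [hf0])
    (by
      apply IsUnit.map
      rw [PowerSeries.isUnit_iff_constantCoeff]
      have h11 : ¬ ((1 : k) + 1 = 0) := by rwa [one_add_one_eq_two]
      simpa using h11)
  have ha' : f = a ^ 2 := by
    have : a ^ 2 - f = 0 := by simpa [Polynomial.IsRoot] using ha
    exact (sub_eq_zero.mp this).symm
  have hxa : x = (HahnSeries.ofPowerSeries ℤ k a) ^ 2 := by
    rw [← hfx, ha', map_pow]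
  refine ⟨_, ?_, hxa⟩
  intro h
  rw [h] at hxa
  exact hx (by simpa using hxa)

lemma order_le_deriv {k : Type*} [Field k] (x : LaurentSeries k) (hx : lsDeriv x ≠ 0) :
    x.order - 1 ≤ (lsDeriv x).order := by
  rw [HahnSeries.le_order_iff_forall hx]
  intro j hj
  have : x.coeff (j + 1) = 0 := HahnSeries.coeff_eq_zero_of_lt_order (by omega)
  simp [lsDeriv, this]

lemma order_div' {k : Type*} [Field k] (x y : LaurentSeries k) (hx : x ≠ 0) (hy : y ≠ 0) :
    (x / y).order = x.order - y.order := by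
  have h := HahnSeries.order_mul (div_ne_zero hx hy) hy
  rw [div_mul_cancel₀ _ hy] at h
  omega

lemma tt_ne {k : Type*} [Field k] : (tt : LaurentSeries k) ≠ 0 := by
  simp [tt]

lemma order_tt {k : Type*} [Field k] : (tt : LaurentSeries k).order = 1 := by
  simp [tt]

lemma order_tt_zpow {k : Type*} [Field k] (m : ℤ) : ((tt : LaurentSeries k) ^ m).order = m := by
  have : (tt : LaurentSeries k) ^ m = HahnSeries.single m 1 := by
    rw [tt, ← RatFunc.single_zpow]
  rw [this]
  simp

lemma two_ne_and_order {k : Type*} [Field k] (h2 : (2 : k) ≠ 0) :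
    (2 : LaurentSeries k) ≠ 0 ∧ ((2 : LaurentSeries k)⁻¹).order = 0 := by
  have h : (2 : LaurentSeries k) = HahnSeries.C 2 := (map_ofNat _ 2).symm
  have hne : (2 : LaurentSeries k) ≠ 0 := by
    rw [h]
    simpa using h2
  refine ⟨hne, ?_⟩
  rw [inv_eq_one_div, order_div' _ _ one_ne_zero hne, h, HahnSeries.order_C]
  simp

/-- Let `α, b, c ∈ K^×` with `b' ≠ 0`, `c' ≠ 0`. Put `n = −ord(t·α)`,
`ν(b) = ord(t·b'/b)`, `ν(c) = ord(t·c'/c)`. Assume `2·ord(α + c·b') ≥ −n + ν(c)`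
(with `ord 0 = +∞`), `2·ν(b) + p·ν(c) < (p−2)·n`, and `n − ν(c)` odd. Then
`(1/2)·t^{n+2−ν(c)}·α·c'/c` has `ord = 0`, with nonzero constant coefficient `γ ∈ k^×`;
and `−t·c'/(2·b')·γ^{−1}` is a square in `K^×`. -/
theorem statement11 (p : ℕ) (hp : p.Prime) (hp2 : 2 < p)
    (k : Type*) [Field k] [PerfectField k] [CharP k p]
    (α b c : LaurentSeries k) (hα : α ≠ 0) (hb : b ≠ 0) (hc : c ≠ 0)
    (hb' : lsDeriv b ≠ 0) (hc' : lsDeriv c ≠ 0)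
    (n νb νc : ℤ)
    (hn : (tt * α).order = -n)
    (hνb : (tt * lsDeriv b / b).order = νb)
    (hνc : (tt * lsDeriv c / c).order = νc)
    (h1 : α + c * lsDeriv b = 0 ∨ -n + νc ≤ 2 * (α + c * lsDeriv b).order)
    (h2 : 2 * νb + (p : ℤ) * νc < ((p : ℤ) - 2) * n)
    (h3 : Odd (n - νc)) :
    (2 : LaurentSeries k)⁻¹ * tt ^ (n + 2 - νc) * α * lsDeriv c / c ≠ 0 ∧
    ((2 : LaurentSeries k)⁻¹ * tt ^ (n + 2 - νc) * α * lsDeriv c / c).order = 0 ∧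
    ((2 : LaurentSeries k)⁻¹ * tt ^ (n + 2 - νc) * α * lsDeriv c / c).coeff 0 ≠ 0 ∧
    ∃ s : LaurentSeries k, s ≠ 0 ∧
      -(tt * lsDeriv c) / (2 * lsDeriv b) *
        (HahnSeries.single (0 : ℤ)
          (((2 : LaurentSeries k)⁻¹ * tt ^ (n + 2 - νc) * α * lsDeriv c / c).coeff 0))⁻¹
        = s ^ 2 := by
  have h2k : (2 : k) ≠ 0 := by
    intro h
    have h' : ((2 : ℕ) : k) = 0 := by exact_mod_cast h
    rw [CharP.cast_eq_zero_iff k p] at h'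
    exact absurd (Nat.le_of_dvd (by norm_num) h') (by omega)
  obtain ⟨h2L, h2o⟩ := two_ne_and_order (k := k) h2k
  have httz : ∀ m : ℤ, (tt : LaurentSeries k) ^ m ≠ 0 := fun m => zpow_ne_zero _ tt_ne
  have ho1 : α.order = -n - 1 := by
    rw [HahnSeries.order_mul tt_ne hα, order_tt] at hn
    omega
  have ho2 : 1 + (lsDeriv b).order - b.order = νb := by
    rw [order_div' _ _ (mul_ne_zero tt_ne hb') hb, HahnSeries.order_mul tt_ne hb', order_tt] at hνb
    exact hνb
  have ho3 : 1 + (lsDeriv c).order - c.order = νc := by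
    rw [order_div' _ _ (mul_ne_zero tt_ne hc') hc, HahnSeries.order_mul tt_ne hc', order_tt] at hνc
    exact hνc
  have hb0 : 0 ≤ νb := by
    have := order_le_deriv b hb'
    omega
  have hc0 : 0 ≤ νc := by
    have := order_le_deriv c hc'
    omega
  have hp3 : (3 : ℤ) ≤ p := by exact_mod_cast hp2
  have hn0 : 0 < n := by
    by_contra hneg
    have : ((p : ℤ) - 2) * n ≤ 0 := mul_nonpos_of_nonneg_of_nonpos (by omega) (by omega)
    have : 0 ≤ (p : ℤ) * νc := by positivity
    omega
  set u : LaurentSeries k :=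
    (2 : LaurentSeries k)⁻¹ * tt ^ (n + 2 - νc) * α * lsDeriv c / c with hu
  have hm1 : (2 : LaurentSeries k)⁻¹ * tt ^ (n + 2 - νc) ≠ 0 :=
    mul_ne_zero (inv_ne_zero h2L) (httz _)
  have hm2 := mul_ne_zero hm1 hα
  have hm3 := mul_ne_zero hm2 hc'
  have hu0 : u ≠ 0 := div_ne_zero hm3 hc
  have huo : u.order = 0 := by
    rw [hu, order_div' _ _ hm3 hc, HahnSeries.order_mul hm2 hc', HahnSeries.order_mul hm1 hα,
      HahnSeries.order_mul (inv_ne_zero h2L) (httz _), h2o, order_tt_zpow, ho1]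
    omega
  have huc : u.coeff 0 ≠ 0 := by
    rw [← huo]
    exact fun h => hu0 (HahnSeries.coeff_order_eq_zero.mp h)
  refine ⟨hu0, huo, huc, ?_⟩
  generalize hγ : u.coeff 0 = γ at huc
  have hG : (HahnSeries.single (0 : ℤ) γ : LaurentSeries k) ≠ 0 := by simpa using huc
  have hGinv : (HahnSeries.single (0 : ℤ) γ : LaurentSeries k)⁻¹ = HahnSeries.single 0 γ⁻¹ := by
    apply inv_eq_of_mul_eq_one_right
    rw [HahnSeries.single_mul_single]
    simp [huc]
  obtain ⟨s2, hs2, hs2'⟩ := isSq_of_one_unit h2k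
    (u * (HahnSeries.single (0 : ℤ) γ : LaurentSeries k)⁻¹)
    (by
      rw [HahnSeries.order_mul hu0 (inv_ne_zero hG), hGinv,
        HahnSeries.order_single (inv_ne_zero huc), huo]
      simp)
    (by
      rw [hGinv]
      simp [hγ, huc])
  have hcb : c * lsDeriv b ≠ 0 := mul_ne_zero hc hb'
  set d := α + c * lsDeriv b with hd
  have hq : (d / α).coeff 0 = 0 ∧ ∀ j < 0, (d / α).coeff j = 0 := by
    rcases eq_or_ne d 0 with h | h
    · simp [h]
    · have h1' := h1.resolve_left h
      have : (d / α).order = d.order - α.order := order_div' _ _ h hα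
      have hpos : 0 < (d / α).order := by omega
      exact ⟨HahnSeries.coeff_eq_zero_of_lt_order hpos,
        fun j hj => HahnSeries.coeff_eq_zero_of_lt_order (by omega)⟩
  have hw : -(c * lsDeriv b) / α = 1 - d / α := by
    rw [hd]
    field_simp
    ring
  have hw0 : (-(c * lsDeriv b) / α).coeff 0 = 1 := by
    rw [hw, HahnSeries.coeff_sub, hq.1]
    simp
  have hwne : -(c * lsDeriv b) / α ≠ 0 := div_ne_zero (neg_ne_zero.mpr hcb) hα
  have hwo : (-(c * lsDeriv b) / α).order = 0 := by
    apply le_antisymm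
    · exact HahnSeries.order_le_of_coeff_ne_zero (by rw [hw0]; exact one_ne_zero)
    · rw [HahnSeries.le_order_iff_forall hwne]
      intro j hj
      rw [hw, HahnSeries.coeff_sub, hq.2 j hj, HahnSeries.coeff_one]
      simp [hj.ne]
  obtain ⟨s1, hs1, hs1'⟩ := isSq_of_one_unit h2k _ hwo hw0
  obtain ⟨j, hj⟩ := h3
  refine ⟨s2 / s1 * (tt ^ (j + 1))⁻¹ * (c / α), ?_, ?_⟩
  · exact mul_ne_zero (mul_ne_zero (div_ne_zero hs2 hs1) (inv_ne_zero (httz _)))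
      (div_ne_zero hc hα)
  · have hT : (tt : LaurentSeries k) ^ (n + 2 - νc) = (tt ^ (j + 1)) ^ 2 * tt := by
      rw [show n + 2 - νc = (j + 1) + (j + 1) + 1 by omega, zpow_add₀ tt_ne, zpow_add₀ tt_ne,
        zpow_one]
      ring
    have hT0 := httz (j + 1)
    rw [mul_pow, mul_pow, div_pow s2, ← hs2', ← hs1', hu, hT]
    have htt := tt_ne (k := k)
    generalize (tt : LaurentSeries k) ^ (j + 1) = T at *
    generalize (HahnSeries.single (0 : ℤ) γ : LaurentSeries k) = G at *
    field_simp


end LFT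
end
end
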